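/- Suppose there exists a prime p such that the pushforward of μ to ℤ/pℤ is the uniform measure on ℤ/pℤ. For M ~ M_n(μ) with characteristic polynomial φ, let F_n be the event that φ has n distinct complex roots, Gal(φ) acts transitively on these roots, and Gal(φ) contains neither the full symmetric group nor the alternating group on the roots. Then P(F_n) → 0 as n → ∞. -/

import Mathlib

/- STATEMENT 5: If μ is uniform modulo some prime p, and F_n is the event that φ has n
distinct complex roots, Gal(φ) is transitive on them, but Gal(φ) contains neither the
full symmetric group nor the alternating group on the roots, then P(F_n) → 0. -/

open scoped Classical

attribute [local instance] Polynomial.Gal.splits_ℚ_ℂ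

noncomputable section

/-- The probability of an event `E` for a random `n × n` integer matrix with
independent entries of law `μ`. -/
def matrixProbZ (n : ℕ) (μ : ℤ → ℝ) (E : Set (Matrix (Fin n) (Fin n) ℤ)) : ℝ :=
  ∑' M : Matrix (Fin n) (Fin n) ℤ, if M ∈ E then (∏ i, ∏ j, μ (M i j)) else 0

/-- The characteristic polynomial of an integer matrix, viewed over ℚ. -/
def charQ {n : ℕ} (M : Matrix (Fin n) (Fin n) ℤ) : Polynomial ℚ :=
  (Matrix.charpoly M).map (Int.castRingHom ℚ)

section GroupTheory

open Equiv Equiv.Perm MulAction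
open scoped Pointwise

/-- If the supports of two permutations meet in a single point, their commutator is a 3-cycle. -/
lemma isThreeCycle_commutator_of_support_inter {α : Type*} [Fintype α] (g k : Perm α) (a : α)
    (hga : g a ≠ a) (hka : k a ≠ a) (h : ∀ x, g x ≠ x → k x ≠ x → x = a) :
    (g * k * g⁻¹ * k⁻¹).IsThreeCycle := by
  have hg' : ∀ x, g x ≠ x → x ≠ a → k x = x := fun x h1 h2 => by
    by_contra h3; exact h2 (h x h1 h3)
  have hk' : ∀ x, k x ≠ x → x ≠ a → g x = x := fun x h1 h2 => by
    by_contra h3; exact h2 (h x h3 h1)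
  have key : g * k * g⁻¹ * k⁻¹ = swap a (k a) * swap a (g a) := by
    rw [mul_inv_eq_iff_eq_mul, mul_inv_eq_iff_eq_mul]
    ext x
    have e1 : k (g a) = g a := hg' _ (by simpa using hga) hga
    have e2 : g (k a) = k a := hk' _ (by simpa using hka) hka
    have e3 : g a ≠ k a := fun h3 => by rw [h3] at e1; exact hka (by simpa using e1)
    simp only [Perm.mul_apply]
    by_cases hxa : x = a
    · subst hxa
      rw [e1, swap_apply_right, swap_apply_left, e2]
    by_cases hgx : g x = x
    · rw [hgx]
      by_cases hkxa : k x = a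
      · rw [hkxa, swap_apply_left, swap_apply_of_ne_of_ne hga e3]
      · have hkx : g (k x) = k x := by
          by_cases hkx : k x = x
          · rw [hkx, hgx]
          · exact hk' _ (by simpa using hkx) hkxa
        rw [hkx, swap_apply_of_ne_of_ne hkxa, swap_apply_of_ne_of_ne hkxa]
        · simpa using hxa
        · intro h1
          apply hga
          have : k x = k (g a) := by rw [h1, e1]
          rw [k.injective this] at hgx
          simpa using hgx
    · have hkx := hg' _ hgx hxa
      by_cases hgxa : g x = a
      · rw [hkx, hgxa, swap_apply_of_ne_of_ne hka e3.symm, swap_apply_right]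
      · have h2 : k (g x) = g x := hg' _ (by simpa using hgx) hgxa
        have h3 : g x ≠ g a := by simpa using hxa
        rw [hkx, h2, swap_apply_of_ne_of_ne hgxa h3, swap_apply_of_ne_of_ne hgxa]
        intro h1
        rw [h1] at h2
        exact hka (by simpa using h2)
  rw [key]
  refine isThreeCycle_swap_mul_swap_same hka.symm hga.symm ?_
  intro h1
  have := hg' (g a) (by simpa using hga) hga
  rw [← h1] at this
  exact hka (by simpa using this)

/-- **Jordan's theorem** for a prime cycle moving at most half of the points. -/
theorem alternatingGroup_le_of_isPreprimitive_of_prime_cycle {α : Type*} [Fintype α]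
    (G : Subgroup (Perm α)) (hG : IsPreprimitive G α) (g : Perm α) (hg : g ∈ G)
    (hgc : g.IsCycle) (hp : g.support.card.Prime) (hle : 2 * g.support.card ≤ Fintype.card α) :
    alternatingGroup α ≤ G := by
  set l := g.support.card with hl
  have hl2 := hp.two_le
  obtain ⟨m, hm⟩ : ∃ m, Fintype.card α - l = m + 1 := ⟨Fintype.card α - l - 1, by omega⟩
  have hsc : Set.ncard ((g.support)ᶜ : Set α) = m + 1 := by
    rw [Set.ncard_compl, Set.ncard_coe_finset, Nat.card_eq_fintype_card, ← hl, hm]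
  have htr := isPretransitive_of_isCycle_mem hgc hg
  have hmul : IsMultiplyPreprimitive G α (m + 2) := by
    refine hG.isMultiplyPreprimitive hsc (by rw [Nat.card_eq_fintype_card]; omega) ?_
    apply IsPreprimitive.of_prime_card
    convert! hp
    rw [Nat.card_eq_fintype_card, Fintype.card_subtype, hl]
    congr 1
    ext z
    simp [SubMulAction.mem_ofFixingSubgroup_iff]
  have hpt : IsMultiplyPretransitive G α (m + 2) := hmul.isMultiplyPretransitive
  have hpt' : IsMultiplyPretransitive G α l :=
    isMultiplyPretransitive_of_le (n := m + 2) (by omega)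
      (by rw [Nat.card_eq_fintype_card]; omega)
  obtain ⟨a, ha, -⟩ := id hgc
  have hcard : (g.support.erase a).card ≤ (g.supportᶜ).card := by
    rw [Finset.card_compl]; have := Finset.card_erase_le (s := g.support) (a := a); omega
  obtain ⟨e⟩ : Nonempty ((g.support.erase a) ↪ (g.supportᶜ : Finset α)) := by
    apply Function.Embedding.nonempty_of_card_le
    rwa [Fintype.card_coe, Fintype.card_coe]
  let f : α → α := fun x => if hx : x ∈ g.support.erase a then (e ⟨x, hx⟩ : α) else a
  let x : Fin l ↪ α := (g.support.equivFin.symm.toEmbedding).trans (Function.Embedding.subtype _)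
  have hxs : ∀ i, x i ∈ g.support := fun i => (g.support.equivFin.symm i).2
  have hfa : f a = a := by simp [f]
  have hfn : ∀ z ∈ g.support, z ≠ a → f z ∉ g.support := by
    intro z hz hza
    have : z ∈ g.support.erase a := Finset.mem_erase.2 ⟨hza, hz⟩
    simp only [f, dif_pos this]
    exact Finset.mem_compl.1 (e ⟨z, this⟩).2
  have has : a ∈ g.support := by simpa using ha
  have hinj : Set.InjOn f g.support := by
    intro u hu v hv huv
    by_cases hua : u = a
    · by_cases hva : v = a
      · rw [hua, hva]
      · rw [hua, hfa] at huv
        exact absurd (huv ▸ has) (hfn v hv hva)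
    · by_cases hva : v = a
      · rw [hva, hfa] at huv
        exact absurd (huv ▸ has) (hfn u hu hua)
      · have h1 : u ∈ g.support.erase a := Finset.mem_erase.2 ⟨hua, hu⟩
        have h2 : v ∈ g.support.erase a := Finset.mem_erase.2 ⟨hva, hv⟩
        simp only [f, dif_pos h1, dif_pos h2] at huv
        simpa using e.injective (Subtype.ext huv)
  let y : Fin l ↪ α := ⟨fun i => f (x i), fun i j hij => x.injective (hinj (hxs i) (hxs j) hij)⟩
  obtain ⟨h, hh⟩ := hpt'.exists_smul_eq x y
  have hmap : ∀ z ∈ g.support, (h : Perm α) z = f z := by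
    intro z hz
    have := DFunLike.congr_fun hh (g.support.equivFin ⟨z, hz⟩)
    simpa [x, y] using! this
  have hk3 : (g * (h * g * (h : Perm α)⁻¹) * g⁻¹ * (h * g * (h : Perm α)⁻¹)⁻¹).IsThreeCycle := by
    have hha : (h : Perm α)⁻¹ a = a := by
      rw [Perm.inv_eq_iff_eq, hmap a has, hfa]
    apply isThreeCycle_commutator_of_support_inter _ _ a ha
    · simp only [Perm.mul_apply, hha]
      rw [Ne, ← Perm.eq_inv_iff_eq, hha]
      exact ha
    · intro z h1 h2
      simp only [Perm.mul_apply, Ne, ← Perm.eq_inv_iff_eq (f := (h : Perm α))] at h2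
      by_contra hza
      have hz : (h : Perm α)⁻¹ z ∈ g.support := by simpa using h2
      by_cases hz2 : (h : Perm α)⁻¹ z = a
      · rw [Perm.inv_eq_iff_eq, hmap a has, hfa] at hz2
        exact hza hz2
      · have h3 := hfn _ hz hz2
        rw [← hmap _ hz] at h3
        simp at h3
        exact h1 h3
  refine alternatingGroup_le_of_isPreprimitive_of_isThreeCycle_mem hG hk3 ?_
  have hk := G.mul_mem (G.mul_mem h.2 hg) (G.inv_mem h.2)
  exact G.mul_mem (G.mul_mem (G.mul_mem hg hk) (G.inv_mem hg)) (G.inv_mem hk)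

end GroupTheory

section CycleLengths

open Equiv Equiv.Perm MulAction Function
open scoped Pointwise

variable {α : Type*} [Fintype α]

lemma mem_periodicPts_perm (σ : Perm α) (x : α) : x ∈ periodicPts σ := by
  refine mk_mem_periodicPts (orderOf_pos σ) ?_
  rw [IsPeriodicPt, Perm.iterate_eq_pow, pow_orderOf_eq_one]; rfl

lemma minimalPeriod_perm_pos (σ : Perm α) (x : α) : 0 < minimalPeriod σ x :=
  minimalPeriod_pos_of_mem_periodicPts (mem_periodicPts_perm σ x)

lemma sameCycle_iff_exists_iterate (σ : Perm α) (x y : α) :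
    σ.SameCycle x y ↔ ∃ i : ℕ, σ^[i] x = y := by
  constructor
  · intro h
    obtain ⟨i, -, hi⟩ := h.exists_pow_eq'
    exact ⟨i, by rw [Perm.iterate_eq_pow]; exact hi⟩
  · rintro ⟨i, hi⟩
    exact ⟨i, by rw [Perm.iterate_eq_pow] at hi; simpa using hi⟩

lemma minimalPeriod_eq_of_sameCycle {σ : Perm α} {x y : α} (h : σ.SameCycle x y) :
    minimalPeriod σ y = minimalPeriod σ x := by
  obtain ⟨i, rfl⟩ := (sameCycle_iff_exists_iterate σ x y).1 h
  exact minimalPeriod_apply_iterate (mem_periodicPts_perm σ x) i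

lemma ncard_sameCycle (σ : Perm α) (x : α) :
    {y | σ.SameCycle x y}.ncard = minimalPeriod σ x := by
  have : {y | σ.SameCycle x y} =
      ((Finset.range (minimalPeriod σ x)).image (fun i => σ^[i] x) : Finset α) := by
    ext y
    simp only [Set.mem_ofPred_eq, sameCycle_iff_exists_iterate, Finset.coe_image, Set.mem_image,
      Finset.coe_range, Set.mem_Iio]
    constructor
    · rintro ⟨i, rfl⟩
      exact ⟨i % minimalPeriod σ x, Nat.mod_lt _ (minimalPeriod_perm_pos σ x),
        iterate_mod_minimalPeriod_eq⟩
    · rintro ⟨i, -, rfl⟩; exact ⟨i, rfl⟩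
  rw [this, Set.ncard_coe_finset, Finset.card_image_of_injOn, Finset.card_range]
  simpa using iterate_injOn_Iio_minimalPeriod (f := σ) (x := x)

section Block

variable {σ : Perm α} {B : Set α}
  (hB : ∀ i : ℕ, ∀ z ∈ B, σ^[i] z ∈ B → σ^[i] '' B = B)

include hB

lemma iterate_mem_block_iff {z : α} (hz : z ∈ B) (i : ℕ) :
    σ^[i] z ∈ B ↔ minimalPeriod (Set.image σ) B ∣ i := by
  rw [← isPeriodicPt_iff_minimalPeriod_dvd, IsPeriodicPt, IsFixedPt, ← Set.image_iterate_eq]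
  exact ⟨hB i z hz, fun h => by rw [← h]; exact Set.mem_image_of_mem _ hz⟩

lemma block_period_dvd {z : α} (hz : z ∈ B) :
    minimalPeriod (Set.image σ) B ∣ minimalPeriod σ z := by
  rw [← iterate_mem_block_iff hB hz, iterate_minimalPeriod]; exact hz

lemma ncard_block_inter_sameCycle {x : α} (hx : x ∈ B) :
    (B ∩ {y | σ.SameCycle x y}).ncard * minimalPeriod (Set.image σ) B = minimalPeriod σ x := by
  set m := minimalPeriod (Set.image σ) B
  obtain ⟨k, hk⟩ := block_period_dvd hB hx
  have hpos := minimalPeriod_perm_pos σ x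
  have hm0 : 0 < m := Nat.pos_of_ne_zero fun h => by
    rw [hk] at hpos; change 0 < m * k at hpos; simp [h] at hpos
  have : B ∩ {y | σ.SameCycle x y} =
      ((Finset.range k).image (fun i => σ^[m * i] x) : Finset α) := by
    ext y
    simp only [Set.mem_inter_iff, Set.mem_ofPred_eq, sameCycle_iff_exists_iterate,
      Finset.coe_image, Set.mem_image, Finset.coe_range, Set.mem_Iio]
    constructor
    · rintro ⟨hy, i, rfl⟩
      obtain ⟨j, rfl⟩ := (iterate_mem_block_iff hB hx i).1 hy
      change ∃ x_1, x_1 < k ∧ σ^[m * x_1] x = σ^[m * j] x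
      have hk0 : 0 < k := Nat.pos_of_ne_zero fun h => by
        rw [hk, h] at hpos; simp at hpos
      refine ⟨j % k, Nat.mod_lt _ hk0, ?_⟩
      rw [← Nat.mul_mod_mul_left, ← hk, iterate_mod_minimalPeriod_eq]
    · rintro ⟨i, -, rfl⟩
      exact ⟨(iterate_mem_block_iff hB hx _).2 (dvd_mul_right _ _), _, rfl⟩
  rw [this, Set.ncard_coe_finset, Finset.card_image_of_injOn, Finset.card_range, hk, mul_comm]
  intro i hi j hj hij
  simp only [Finset.coe_range, Set.mem_Iio] at hi hj
  have := iterate_injOn_Iio_minimalPeriod (f := σ) (x := x)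
    (show m * i ∈ Set.Iio (minimalPeriod σ x) by
      rw [hk]; exact (Nat.mul_lt_mul_left hm0).2 hi)
    (show m * j ∈ Set.Iio (minimalPeriod σ x) by
      rw [hk]; exact (Nat.mul_lt_mul_left hm0).2 hj) hij
  exact Nat.eq_of_mul_eq_mul_left hm0 this

end Block

/-- If no other cycle of `σ` has length divisible by the prime length of the cycle of `x`, then
some power of `σ` is a cycle supported on the cycle of `x`. -/
lemma exists_pow_isCycle (σ : Perm α) (x : α) (hp : (minimalPeriod σ x).Prime)
    (h : ∀ y, minimalPeriod σ x ∣ minimalPeriod σ y → σ.SameCycle x y) :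
    ∃ k : ℕ, (σ ^ k).IsCycle ∧ (σ ^ k).support.card = minimalPeriod σ x := by
  set l := minimalPeriod σ x with hl
  let k := ∏ y ∈ Finset.univ.filter (fun y => ¬ σ.SameCycle x y), minimalPeriod σ y
  have hlk : ¬ l ∣ k := by
    intro hd
    obtain ⟨y, hy, hly⟩ := (hp.prime.dvd_finsetProd_iff _).1 hd
    exact (Finset.mem_filter.1 hy).2 (h y hly)
  have hfix : ∀ y, (σ ^ k) y ≠ y ↔ σ.SameCycle x y := by
    intro y
    have e : (σ ^ k) y = y ↔ minimalPeriod σ y ∣ k := by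
      rw [← isPeriodicPt_iff_minimalPeriod_dvd, IsPeriodicPt, IsFixedPt, Perm.iterate_eq_pow]
    rw [Ne, e]
    constructor
    · intro hy
      by_contra hc
      exact hy (Finset.dvd_prod_of_mem _ (by simpa using hc))
    · intro hy
      rwa [minimalPeriod_eq_of_sameCycle hy]
  refine ⟨k, ⟨x, (hfix x).2 (SameCycle.refl σ x), ?_⟩, ?_⟩
  · intro y hy
    obtain ⟨i, rfl⟩ := (sameCycle_iff_exists_iterate σ x y).1 ((hfix y).1 hy)
    have hc : Nat.Coprime k l := ((Nat.Prime.coprime_iff_not_dvd hp).2 hlk).symm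
    rw [sameCycle_iff_exists_iterate]
    obtain ⟨j, -, hj⟩ := Nat.exists_mul_mod_eq_one_of_coprime hc hp.one_lt
    refine ⟨j * i, ?_⟩
    rw [Perm.iterate_eq_pow, ← pow_mul, ← Perm.iterate_eq_pow,
      ← iterate_mod_minimalPeriod_eq (n := i), ← iterate_mod_minimalPeriod_eq (n := k * (j * i)),
      ← hl, ← mul_assoc, Nat.mul_mod, hj, one_mul, Nat.mod_mod]
  · rw [← Set.ncard_coe_finset, hl, ← ncard_sameCycle]
    congr 1
    ext y
    simpa using hfix y

/-- A transitive group containing a permutation with suitable cycle lengths contains the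
alternating group. -/
theorem alternatingGroup_le_of_cycle_lengths (G : Subgroup (Perm α)) [hT : IsPretransitive G α]
    (σ : Perm α) (hσ : σ ∈ G) (y R N₀ : ℕ) (x₀ x₁ x₂ : α)
    (hprime : (minimalPeriod σ x₀).Prime) (hy : y ≤ minimalPeriod σ x₀)
    (hhalf : 2 * minimalPeriod σ x₀ ≤ Fintype.card α)
    (hgcd : ∀ x x' m, y ≤ m → m ∣ minimalPeriod σ x → m ∣ minimalPeriod σ x' → σ.SameCycle x x')
    (hinv : ∀ r, 2 ≤ r → r ≤ R → ∀ U : Set α, (∀ x, x ∈ U ↔ σ x ∈ U) →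
      U.ncard * r ≠ Fintype.card α)
    (hne : ¬ σ.SameCycle x₁ x₂) (h₁ : N₀ ≤ minimalPeriod σ x₁) (h₂ : N₀ ≤ minimalPeriod σ x₂)
    (hN₀ : y * Fintype.card α ≤ N₀ * R) :
    alternatingGroup α ≤ G := by
  obtain ⟨k, hk, hks⟩ := exists_pow_isCycle σ x₀ hprime
    (fun z hz => hgcd x₀ z _ hy dvd_rfl hz)
  suffices hP : IsPreprimitive G α from
    alternatingGroup_le_of_isPreprimitive_of_prime_cycle G hP (σ ^ k) (G.pow_mem hσ k) hk
      (hks ▸ hprime) (hks ▸ hhalf)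
  refine ⟨fun {B₀} hB₀ => ?_⟩
  by_contra hcon
  rw [IsTrivialBlock, not_or] at hcon
  obtain ⟨hns, hnu⟩ := hcon
  have hne₀ : B₀.Nonempty := (Set.not_subsingleton_iff.1 hns).nonempty
  set s := B₀.ncard with hs
  have hblk : ∀ x : α, ∃ B : Set α, x ∈ B ∧ B.ncard = s ∧
      (∀ i : ℕ, ∀ z ∈ B, σ^[i] z ∈ B → σ^[i] '' B = B) := by
    intro x
    obtain ⟨b, hb⟩ := hne₀
    obtain ⟨g, hg⟩ := hT.exists_smul_eq b x
    refine ⟨g • B₀, hg ▸ Set.smul_mem_smul_set hb, ?_, ?_⟩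
    · rw [hs, Set.ncard_smul_set]
    · intro i z hz hz'
      have hB := hB₀.translate g
      rw [Perm.iterate_eq_pow] at hz' ⊢
      exact isBlock_iff_smul_eq_of_mem.1 hB (g := ⟨σ ^ i, G.pow_mem hσ i⟩) hz hz'
  have hcard := hB₀.ncard_block_mul_ncard_orbit_eq hne₀
  rw [Nat.card_eq_fintype_card] at hcard
  set r := (orbit G B₀).ncard with hr
  have hs2 : 2 ≤ s := by
    by_contra hlt
    exact hns ((Set.ncard_le_one_iff_subsingleton).1 (by omega))
  have hn0 : 0 < Fintype.card α := Fintype.card_pos_iff.2 ⟨x₀⟩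
  have hr2 : 2 ≤ r := by
    by_contra hlt
    apply hnu
    rw [Set.eq_univ_iff_ncard, Nat.card_eq_fintype_card, ← hcard, ← hs]
    interval_cases r
    · simp at hcard; omega
    · simp
  have hsy : y ≤ s ∧ R < r := by
    obtain ⟨B, hxB, hBs, hB⟩ := hblk x₀
    have hdvd := block_period_dvd hB hxB
    rcases (Nat.dvd_prime hprime).1 hdvd with h1 | h1
    · have hall := fun z (hz : z ∈ B) i => (iterate_mem_block_iff hB hz i)
      simp only [h1, one_dvd, iff_true] at hall
      constructor
      · refine hy.trans ?_
        rw [← ncard_sameCycle, ← hBs]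
        apply Set.ncard_le_ncard _ (Set.toFinite _)
        intro z hz
        obtain ⟨i, rfl⟩ := (sameCycle_iff_exists_iterate _ _ _).1 hz
        exact hall x₀ hxB i
      · by_contra hle
        refine hinv r hr2 (by omega) B (fun x => ⟨fun hx => hall x hx 1, fun hx => ?_⟩)
          (by rw [hBs, hcard])
        have h3 : σ.SameCycle (σ x) x := (sameCycle_apply_left.2 (SameCycle.refl σ x))
        obtain ⟨i, hi⟩ := (sameCycle_iff_exists_iterate _ _ _).1 h3
        rw [← hi]
        exact hall _ hx i
    · exfalso
      have : B.ncard ≤ 1 := by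
        rw [Set.ncard_le_one_iff_subsingleton]
        have key : ∀ z ∈ B, z = x₀ := by
          intro z hz
          have h3 := hgcd x₀ z _ hy dvd_rfl (h1 ▸ block_period_dvd hB hz)
          obtain ⟨i, hi⟩ := (sameCycle_iff_exists_iterate _ _ _).1 h3
          rw [← hi] at hz ⊢
          rw [iterate_mem_block_iff hB hxB, h1, ← isPeriodicPt_iff_minimalPeriod_dvd] at hz
          exact hz
        intro z hz w hw
        rw [key z hz, key w hw]
      omega
  have hdiv : ∀ x, N₀ ≤ minimalPeriod σ x → s ∣ minimalPeriod σ x := by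
    intro x hx
    obtain ⟨B, hxB, hBs, hB⟩ := hblk x
    have h3 := ncard_block_inter_sameCycle hB hxB
    have hle : (B ∩ {y | σ.SameCycle x y}).ncard ≤ s := by
      rw [← hBs]; exact Set.ncard_le_ncard Set.inter_subset_left (Set.toFinite _)
    set m := minimalPeriod (Set.image σ) B
    have hm : y ≤ m := by
      have e1 : s * r * y ≤ s * r * m := by
        calc s * r * y ≤ N₀ * R := by rw [hcard, mul_comm]; exact hN₀
          _ ≤ (s * m) * r :=
            Nat.mul_le_mul (hx.trans (h3 ▸ Nat.mul_le_mul_right _ hle)) hsy.2.le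
          _ = s * r * m := by ring
      exact Nat.le_of_mul_le_mul_left e1 (by rw [hcard]; exact hn0)
    have : B ∩ {y | σ.SameCycle x y} = B := by
      apply Set.inter_eq_left.2
      intro z hz
      exact hgcd x z m hm (block_period_dvd hB hxB) (block_period_dvd hB hz)
    rw [this, hBs] at h3
    exact ⟨_, h3.symm⟩
  exact hne (hgcd x₁ x₂ s hsy.1 (hdiv x₁ h₁) (hdiv x₂ h₂))

end CycleLengths

section PolynomialCounting

open Polynomial UniqueFactorizationMonoid

variable (F : Type*) [Field F] [Fintype F]

lemma finite_monic_natDegree_eq (n : ℕ) : {f : F[X] | f.Monic ∧ f.natDegree = n}.Finite := by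
  have e := (monicEquivDegreeLT (R := F) n).trans (degreeLTEquiv F n).toEquiv
  exact Set.finite_coe_iff.1 (Finite.of_equiv _ e.symm)

/-- The monic polynomials of degree `n` over a finite field. -/
def monics (n : ℕ) : Finset F[X] := (finite_monic_natDegree_eq F n).toFinset

/-- The monic irreducible polynomials of degree `n` over a finite field. -/
def irreds (n : ℕ) : Finset F[X] := (monics F n).filter Irreducible

variable {F}

@[simp] lemma mem_monics {n : ℕ} {f : F[X]} : f ∈ monics F n ↔ f.Monic ∧ f.natDegree = n := by
  simp [monics]

lemma mem_irreds {n : ℕ} {f : F[X]} :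
    f ∈ irreds F n ↔ (f.Monic ∧ f.natDegree = n) ∧ Irreducible f := by
  simp [irreds]

lemma card_monics (n : ℕ) : (monics F n).card = Fintype.card F ^ n := by
  have e := (monicEquivDegreeLT (R := F) n).trans (degreeLTEquiv F n).toEquiv
  have : Nat.card {f : F[X] // f.Monic ∧ f.natDegree = n} = Fintype.card F ^ n := by
    rw [Nat.card_congr e]; simp
  rw [← this, ← Set.ncard_coe_finset]
  simp only [monics, Set.Finite.coe_toFinset]
  rfl

lemma monics_zero : monics F 0 = {1} := by
  ext f
  simp only [mem_monics, Finset.mem_singleton]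
  constructor
  · rintro ⟨h1, h2⟩; exact (h1.natDegree_eq_zero).1 h2
  · rintro rfl; simp

lemma sum_monics_dvd {M : Type*} [AddCommMonoid M] {d n : ℕ} (hd : d ≤ n) {D : F[X]}
    (hD : D ∈ monics F d) (G : F[X] → M) :
    ∑ f ∈ monics F n with D ∣ f, G f = ∑ h ∈ monics F (n - d), G (D * h) := by
  rw [mem_monics] at hD
  symm
  refine Finset.sum_bij (fun h _ => D * h) ?_ ?_ ?_ (fun _ _ => rfl)
  · intro h hh
    rw [mem_monics] at hh
    simp only [Finset.mem_filter, mem_monics, dvd_mul_right, and_true]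
    refine ⟨hD.1.mul hh.1, ?_⟩
    rw [hD.1.natDegree_mul hh.1, hD.2, hh.2]; omega
  · intro a _ b _ hab
    exact mul_left_cancel₀ hD.1.ne_zero hab
  · intro f hf
    simp only [Finset.mem_filter, mem_monics] at hf
    obtain ⟨⟨h1, h2⟩, c, rfl⟩ := hf
    have hc : c.Monic := hD.1.of_mul_monic_left h1
    rw [hD.1.natDegree_mul hc] at h2
    exact ⟨c, by simp only [mem_monics]; exact ⟨hc, by omega⟩, rfl⟩

lemma monics_filter_dvd_eq_empty {d n : ℕ} (hd : n < d) {D : F[X]} (hD : D ∈ monics F d) :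
    {f ∈ monics F n | D ∣ f} = ∅ := by
  rw [mem_monics] at hD
  apply Finset.filter_eq_empty_iff.2
  intro f hf hdvd
  rw [mem_monics] at hf
  have := natDegree_le_of_dvd hdvd hf.1.ne_zero
  omega

lemma card_monics_dvd {d n : ℕ} (hd : d ≤ n) {D : F[X]} (hD : D ∈ monics F d) :
    ({f ∈ monics F n | D ∣ f}).card = Fintype.card F ^ (n - d) := by
  rw [Finset.card_eq_sum_ones, sum_monics_dvd hd hD, ← Finset.card_eq_sum_ones, card_monics]

/-- The proportion of monic polynomials of degree `n` divisible by `D` is at most `q ^ (-deg D)`. -/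
lemma card_monics_dvd_le {d n : ℕ} {D : F[X]} (hD : D ∈ monics F d) :
    (({f ∈ monics F n | D ∣ f}).card : ℝ) ≤
      (Fintype.card F : ℝ) ^ n * ((Fintype.card F : ℝ) ^ d)⁻¹ := by
  have hq : (0 : ℝ) < Fintype.card F := by exact_mod_cast Fintype.card_pos
  rcases le_or_gt d n with h | h
  · rw [card_monics_dvd h hD]
    push_cast
    rw [pow_sub₀ _ hq.ne' h]
  · rw [monics_filter_dvd_eq_empty h hD]
    simp; positivity

lemma pow_dvd_iff_le_count_of_monic {P f : F[X]} (hP : Irreducible P) (hPm : P.Monic)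
    (hf : f ≠ 0) (j : ℕ) : P ^ j ∣ f ↔ j ≤ (normalizedFactors f).count P := by
  rw [pow_dvd_iff_le_emultiplicity, emultiplicity_eq_count_normalizedFactors hP hf,
    hPm.normalize_eq_self]
  simp

lemma natDegree_eq_sum_normalizedFactors {f : F[X]} (hf : f.Monic) :
    f.natDegree = ((normalizedFactors f).map natDegree).sum := by
  have h := prod_normalizedFactors_eq hf.ne_zero
  rw [hf.normalize_eq_self] at h
  conv_lhs => rw [← h]
  apply natDegree_multiset_prod_of_monic
  intro P hP
  have := Polynomial.Monic.normalize_eq_self (p := P)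
  have h2 := normalize_normalized_factor P hP
  rw [← h2]
  exact monic_normalize (irreducible_of_normalized_factor P hP).ne_zero

lemma monic_of_mem_normalizedFactors {f P : F[X]} (hP : P ∈ normalizedFactors f) : P.Monic := by
  rw [← normalize_normalized_factor P hP]
  exact monic_normalize (irreducible_of_normalized_factor P hP).ne_zero

lemma mem_normalizedFactors_iff_of_monic {f P : F[X]} (hf : f ≠ 0) :
    P ∈ normalizedFactors f ↔ Irreducible P ∧ P.Monic ∧ P ∣ f := by
  constructor
  · intro h
    exact ⟨irreducible_of_normalized_factor P h, monic_of_mem_normalizedFactors h,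
      dvd_of_mem_normalizedFactors h⟩
  · rintro ⟨h1, h2, h3⟩
    rw [mem_normalizedFactors_iff' hf]
    exact ⟨h1, h2.normalize_eq_self, h3⟩

/-- The degree of a monic polynomial as a sum over the prime powers dividing it. -/
lemma natDegree_eq_sum_pow_dvd {n : ℕ} {f : F[X]} (hf : f ∈ monics F n) :
    n = ∑ m ∈ Finset.Icc 1 n, ∑ x ∈ m.divisorsAntidiagonal, ∑ P ∈ irreds F x.1,
      if P ^ x.2 ∣ f then x.1 else 0 := by
  rw [mem_monics] at hf
  have hf0 := hf.1.ne_zero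
  have h1 : n = ∑ y ∈ (normalizedFactors f).toFinset.sigma
      (fun P => Finset.Icc 1 ((normalizedFactors f).count P)), y.1.natDegree := by
    rw [Finset.sum_sigma]
    conv_lhs => rw [← hf.2, natDegree_eq_sum_normalizedFactors hf.1,
      Finset.sum_multiset_map_count]
    simp
  conv_lhs => rw [h1]
  simp_rw [Finset.sum_sigma']
  rw [← Finset.sum_filter]
  symm
  refine Finset.sum_bij' (fun z _ => ⟨z.2.2, z.2.1.2⟩)
    (fun y _ => ⟨y.1.natDegree * y.2, ⟨(y.1.natDegree, y.2), y.1⟩⟩) ?_ ?_ ?_ ?_ ?_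
  · rintro ⟨m, x, P⟩ h
    simp only [Finset.mem_filter, Finset.mem_sigma, Finset.mem_Icc, Nat.mem_divisorsAntidiagonal,
      mem_irreds] at h
    obtain ⟨⟨hm, ⟨hx, -⟩, hP⟩, hd⟩ := h
    have hx2 : x.2 ≠ 0 := fun h => by rw [h] at hx; omega
    simp only [Finset.mem_sigma, Multiset.mem_toFinset, Finset.mem_Icc,
      mem_normalizedFactors_iff_of_monic hf0]
    exact ⟨⟨hP.2, hP.1.1, (dvd_pow_self P hx2).trans hd⟩, by omega,
      (pow_dvd_iff_le_count_of_monic hP.2 hP.1.1 hf0 _).1 hd⟩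
  · rintro ⟨P, j⟩ h
    simp only [Finset.mem_sigma, Multiset.mem_toFinset, Finset.mem_Icc,
      mem_normalizedFactors_iff_of_monic hf0] at h
    obtain ⟨⟨hP, hPm, -⟩, hj1, hj⟩ := h
    have hd := (pow_dvd_iff_le_count_of_monic hP hPm hf0 _).2 hj
    have hdeg := natDegree_le_of_dvd hd hf0
    rw [hPm.natDegree_pow, hf.2] at hdeg
    have := hP.natDegree_pos
    simp only [Finset.mem_filter, Finset.mem_sigma, Finset.mem_Icc, Nat.mem_divisorsAntidiagonal,
      mem_irreds]
    refine ⟨⟨⟨Nat.mul_pos this hj1, by rw [mul_comm]; exact hdeg⟩, ⟨trivial, ?_⟩, ⟨hPm, trivial⟩, hP⟩, hd⟩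
    exact (Nat.mul_pos this hj1).ne'
  · rintro ⟨m, x, P⟩ h
    simp only [Finset.mem_filter, Finset.mem_sigma, Finset.mem_Icc, Nat.mem_divisorsAntidiagonal,
      mem_irreds] at h
    obtain ⟨⟨hm, ⟨hx, -⟩, hP⟩, hd⟩ := h
    rcases x with ⟨a, b⟩
    simp only at hP hx
    obtain rfl := hP.1.2
    subst hx
    rfl
  · rintro ⟨P, j⟩ h; rfl
  · rintro ⟨m, x, P⟩ h
    simp only [Finset.mem_filter, Finset.mem_sigma, mem_irreds] at h
    exact h.1.2.2.1.2.symm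

lemma pow_mem_monics {d j : ℕ} {P : F[X]} (hP : P ∈ irreds F d) : P ^ j ∈ monics F (d * j) := by
  rw [mem_irreds] at hP
  rw [mem_monics]
  exact ⟨hP.1.1.pow j, by rw [hP.1.1.natDegree_pow, hP.1.2, mul_comm]⟩

/-- Summing a weight over monic polynomials by pulling out prime powers. -/
lemma natDegree_mul_sum_monics (n : ℕ) (G : F[X] → ℝ) :
    n * ∑ f ∈ monics F n, G f = ∑ m ∈ Finset.Icc 1 n, ∑ x ∈ m.divisorsAntidiagonal,
      ∑ P ∈ irreds F x.1, (x.1 : ℝ) * ∑ h ∈ monics F (n - m), G (P ^ x.2 * h) := by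
  have h1 : n * ∑ f ∈ monics F n, G f = ∑ f ∈ monics F n, ∑ m ∈ Finset.Icc 1 n,
      ∑ x ∈ m.divisorsAntidiagonal, ∑ P ∈ irreds F x.1,
        if P ^ x.2 ∣ f then (x.1 : ℝ) * G f else 0 := by
    rw [Finset.mul_sum]
    refine Finset.sum_congr rfl fun f hf => ?_
    have := natDegree_eq_sum_pow_dvd hf
    conv_lhs => rw [this]
    push_cast
    simp_rw [Finset.sum_mul, ite_mul, zero_mul]
  rw [h1, Finset.sum_comm]
  refine Finset.sum_congr rfl fun m hm => ?_
  rw [Finset.sum_comm]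
  refine Finset.sum_congr rfl fun x hx => ?_
  rw [Finset.sum_comm]
  refine Finset.sum_congr rfl fun P hP => ?_
  rw [Nat.mem_divisorsAntidiagonal] at hx
  have hP' := pow_mem_monics (j := x.2) hP
  rw [hx.1] at hP'
  rw [← Finset.sum_filter, sum_monics_dvd (Finset.mem_Icc.1 hm).2 hP', Finset.mul_sum]

/-- **Gauss's formula**: `∑_{d ∣ m} d N_d = q ^ m`. -/
lemma sum_divisors_mul_card_irreds {m : ℕ} (hm : m ≠ 0) :
    ∑ x ∈ m.divisorsAntidiagonal, (x.1 : ℝ) * (irreds F x.1).card = (Fintype.card F : ℝ) ^ m := by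
  have hq : (0 : ℝ) < Fintype.card F := by exact_mod_cast Fintype.card_pos
  induction m using Nat.strong_induction_on with
  | _ n ih =>
    have h := natDegree_mul_sum_monics (F := F) n (fun _ => 1)
    simp only [Finset.sum_const, card_monics, nsmul_eq_mul, mul_one] at h
    obtain ⟨k, rfl⟩ := Nat.exists_eq_succ_of_ne_zero hm
    rw [Nat.succ_eq_add_one, Finset.sum_Icc_succ_top (by omega)] at h
    have h2 : ∑ m ∈ Finset.Icc 1 k, ∑ x ∈ m.divisorsAntidiagonal,
        ((irreds F x.1).card : ℝ) * (x.1 * ((Fintype.card F ^ (k + 1 - m) : ℕ) : ℝ)) =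
        ∑ m ∈ Finset.Icc 1 k, (Fintype.card F : ℝ) ^ (k + 1) := by
      refine Finset.sum_congr rfl fun m hm => ?_
      have hm' := Finset.mem_Icc.1 hm
      push_cast
      rw [show k + 1 = m + (k + 1 - m) by omega, pow_add, ← ih m (by omega) (by omega),
        Finset.sum_mul]
      refine Finset.sum_congr rfl fun x _ => ?_
      rw [show m + (k + 1 - m) - m = k + 1 - m by omega]
      ring
    rw [h2] at h
    simp only [Finset.sum_const, Nat.card_Icc, nsmul_eq_mul, Nat.add_sub_cancel, Nat.sub_self,
      pow_zero, Nat.cast_one, mul_one] at h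
    push_cast at h
    have h3 : ∑ x ∈ (k + 1).divisorsAntidiagonal, (x.1 : ℝ) * (irreds F x.1).card =
      ∑ x ∈ (k + 1).divisorsAntidiagonal, ((irreds F x.1).card : ℝ) * x.1 :=
      Finset.sum_congr rfl fun x _ => mul_comm _ _
    rw [Nat.succ_eq_add_one, h3]
    linarith

/-- The coefficient of `t ^ n` in `(1 - t) ^ (-z)`. -/
def risingCoeff (z : ℝ) (n : ℕ) : ℝ := ∏ i ∈ Finset.range n, (z + i) / (i + 1)

lemma risingCoeff_nonneg {z : ℝ} (hz : 0 ≤ z) (n : ℕ) : 0 ≤ risingCoeff z n :=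
  Finset.prod_nonneg fun i _ => by positivity

lemma risingCoeff_succ (z : ℝ) (n : ℕ) :
    risingCoeff z (n + 1) = risingCoeff z n * ((z + n) / (n + 1)) := by
  rw [risingCoeff, Finset.prod_range_succ]; rfl

lemma mul_risingCoeff (z : ℝ) (n : ℕ) :
    n * risingCoeff z n = z * ∑ k ∈ Finset.range n, risingCoeff z k := by
  induction n with
  | zero => simp
  | succ n ih =>
    rw [Finset.sum_range_succ, mul_add, ← ih, risingCoeff_succ]
    push_cast
    field_simp
    ring

/-- A submultiplicative-type weight has mean value bounded by a rising coefficient. -/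
lemma sum_monics_le_risingCoeff {z : ℝ} (hz : 0 ≤ z) (G : F[X] → ℝ) (h1 : G 1 ≤ 1)
    (hG : ∀ P h : F[X], Irreducible P → P.Monic → h.Monic → ∀ j, 1 ≤ j →
      G (P ^ j * h) ≤ z * G h) (n : ℕ) :
    ∑ f ∈ monics F n, G f ≤ (Fintype.card F : ℝ) ^ n * risingCoeff z n := by
  have hq : (0 : ℝ) < Fintype.card F := by exact_mod_cast Fintype.card_pos
  induction n using Nat.strong_induction_on with
  | _ n ih =>
    rcases Nat.eq_zero_or_pos n with rfl | hn
    · simpa [monics_zero, risingCoeff] using h1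
    have h := natDegree_mul_sum_monics (F := F) n G
    have h2 : n * ∑ f ∈ monics F n, G f ≤
        n * ((Fintype.card F : ℝ) ^ n * risingCoeff z n) := by
      rw [h]
      calc _ ≤ ∑ m ∈ Finset.Icc 1 n, ∑ x ∈ m.divisorsAntidiagonal, ∑ P ∈ irreds F x.1,
            (x.1 : ℝ) * (z * ∑ h ∈ monics F (n - m), G h) := by
            refine Finset.sum_le_sum fun m hm => Finset.sum_le_sum fun x hx =>
              Finset.sum_le_sum fun P hP => ?_
            rw [Nat.mem_divisorsAntidiagonal] at hx
            rw [mem_irreds] at hP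
            refine mul_le_mul_of_nonneg_left ?_ (Nat.cast_nonneg _)
            rw [Finset.mul_sum]
            refine Finset.sum_le_sum fun h hh => hG P h hP.2 hP.1.1 (mem_monics.1 hh).1 _ ?_
            exact Nat.one_le_iff_ne_zero.2 fun h0 => hx.2 (by rw [← hx.1, h0, mul_zero])
        _ = ∑ m ∈ Finset.Icc 1 n, (Fintype.card F : ℝ) ^ m *
              (z * ∑ h ∈ monics F (n - m), G h) := by
            refine Finset.sum_congr rfl fun m hm => ?_
            rw [← sum_divisors_mul_card_irreds (by have := (Finset.mem_Icc.1 hm).1; omega),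
              Finset.sum_mul]
            refine Finset.sum_congr rfl fun x _ => ?_
            rw [Finset.sum_const, nsmul_eq_mul]; ring
        _ ≤ ∑ m ∈ Finset.Icc 1 n, (Fintype.card F : ℝ) ^ m *
              (z * ((Fintype.card F : ℝ) ^ (n - m) * risingCoeff z (n - m))) := by
            refine Finset.sum_le_sum fun m hm => ?_
            have hm' := Finset.mem_Icc.1 hm
            gcongr
            exact ih (n - m) (by omega)
        _ = (Fintype.card F : ℝ) ^ n * (z * ∑ m ∈ Finset.Icc 1 n, risingCoeff z (n - m)) := by
            rw [Finset.mul_sum, Finset.mul_sum]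
            refine Finset.sum_congr rfl fun m hm => ?_
            have hm' := Finset.mem_Icc.1 hm
            rw [show (Fintype.card F : ℝ) ^ n = Fintype.card F ^ m * Fintype.card F ^ (n - m) by
              rw [← pow_add]; congr 1; omega]
            ring
        _ = n * ((Fintype.card F : ℝ) ^ n * risingCoeff z n) := by
            have e : ∑ m ∈ Finset.Icc 1 n, risingCoeff z (n - m) =
                ∑ k ∈ Finset.range n, risingCoeff z k := by
              rw [← Finset.sum_range_reflect]
              refine Finset.sum_bij' (fun m _ => m - 1) (fun k _ => k + 1) ?_ ?_ ?_ ?_ ?_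
              all_goals intro a ha
              all_goals simp only [Finset.mem_Icc, Finset.mem_range] at ha ⊢
              · omega
              · omega
              · omega
              · omega
              · congr 1; omega
            rw [e, ← mul_risingCoeff]; ring
    exact le_of_mul_le_mul_left h2 (by exact_mod_cast hn)

lemma risingCoeff_half_le (n : ℕ) : risingCoeff (1 / 2) n ^ 2 * (2 * n + 1) ≤ 1 := by
  induction n with
  | zero => simp [risingCoeff]
  | succ n ih =>
    have h : risingCoeff (1 / 2) (n + 1) ^ 2 * (2 * (n + 1 : ℕ) + 1) =
        (risingCoeff (1 / 2) n ^ 2 * (2 * n + 1)) *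
          ((2 * n + 1) * (2 * n + 3) / (2 * n + 2) ^ 2) := by
      rw [risingCoeff_succ]; push_cast; field_simp; ring
    rw [h]
    refine mul_le_one₀ ih (by positivity) ?_
    rw [div_le_one (by positivity)]
    nlinarith

lemma risingCoeff_three_halves_le (n : ℕ) : risingCoeff (3 / 2) n ^ 2 ≤ 2 * n + 1 := by
  induction n with
  | zero => simp [risingCoeff]
  | succ n ih =>
    rw [risingCoeff_succ, mul_pow]
    calc _ ≤ (2 * n + 1 : ℝ) * ((3 / 2 + n) / (n + 1)) ^ 2 := by gcongr
      _ ≤ _ := by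
        rw [div_pow, ← mul_div_assoc, div_le_iff₀ (by positivity)]
        push_cast
        have : (0 : ℝ) ≤ n := Nat.cast_nonneg n
        nlinarith

end PolynomialCounting

section TypicalFactorization

open Polynomial UniqueFactorizationMonoid

variable {F : Type*} [Field F] [Fintype F]

lemma two_le_card_field : (2 : ℝ) ≤ Fintype.card F := by
  exact_mod_cast Fintype.one_lt_card (α := F)

lemma mul_card_irreds_le {d : ℕ} (hd : d ≠ 0) :
    (d : ℝ) * (irreds F d).card ≤ (Fintype.card F : ℝ) ^ d := by
  rw [← sum_divisors_mul_card_irreds hd]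
  exact Finset.single_le_sum (f := fun x : ℕ × ℕ => (x.1 : ℝ) * (irreds F x.1).card)
    (fun x _ => by positivity)
    (show (d, 1) ∈ d.divisorsAntidiagonal by simp [hd])

lemma sum_Icc_pow_le {q : ℝ} (hq : 2 ≤ q) (s : ℕ) : ∑ e ∈ Finset.Icc 1 s, q ^ e ≤ 2 * q ^ s := by
  induction s with
  | zero => simp
  | succ s ih =>
    rw [Finset.sum_Icc_succ_top (by omega)]
    have : q ^ (s + 1) = q * q ^ s := pow_succ' q s
    have h0 : 0 < q ^ s := by positivity
    nlinarith

/-- A lower bound for the number of monic irreducible polynomials of a given degree. -/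
lemma le_mul_card_irreds {d : ℕ} (hd : 3 ≤ d) :
    (Fintype.card F : ℝ) ^ d ≤ 2 * d * (irreds F d).card := by
  have hq := two_le_card_field (F := F)
  have h := sum_divisors_mul_card_irreds (F := F) (m := d) (by omega)
  rw [Nat.sum_divisorsAntidiagonal (f := fun i _ => (i : ℝ) * (irreds F i).card),
    ← Nat.insert_self_properDivisors (by omega),
    Finset.sum_insert Nat.self_notMem_properDivisors] at h
  have h2 : ∑ i ∈ d.properDivisors, (i : ℝ) * (irreds F i).card ≤
      2 * (Fintype.card F : ℝ) ^ (d / 2) := by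
    refine le_trans ?_ (sum_Icc_pow_le hq (d / 2))
    calc _ ≤ ∑ i ∈ d.properDivisors, (Fintype.card F : ℝ) ^ i := by
          refine Finset.sum_le_sum fun i hi => mul_card_irreds_le ?_
          exact (Nat.pos_of_mem_properDivisors hi).ne'
      _ ≤ _ := by
          refine Finset.sum_le_sum_of_subset_of_nonneg ?_ fun _ _ _ => by positivity
          intro i hi
          have h1 := Nat.pos_of_mem_properDivisors hi
          rw [Nat.mem_properDivisors] at hi
          obtain ⟨⟨c, hc⟩, hlt⟩ := hi
          rw [Finset.mem_Icc]
          refine ⟨h1, ?_⟩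
          have : 2 ≤ c := by
            by_contra hcon
            interval_cases c <;> omega
          rw [Nat.le_div_iff_mul_le (by norm_num), hc]
          exact Nat.mul_le_mul_left i this
  have h3 : 4 * (Fintype.card F : ℝ) ^ (d / 2) ≤ (Fintype.card F : ℝ) ^ d := by
    rw [show (Fintype.card F : ℝ) ^ d =
      (Fintype.card F : ℝ) ^ (d - d / 2) * (Fintype.card F : ℝ) ^ (d / 2) by
        rw [← pow_add]; congr 1; omega]
    gcongr
    calc (4 : ℝ) = 2 ^ 2 := by norm_num
      _ ≤ (Fintype.card F : ℝ) ^ 2 := by gcongr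
      _ ≤ _ := pow_le_pow_right₀ (by linarith) (by omega)
  linarith

/-- The total degree of the prime powers of exponent at least two exactly dividing `f`. -/
def sqful (f : F[X]) : ℕ := ∑ P ∈ (normalizedFactors f).toFinset,
  if 2 ≤ (normalizedFactors f).count P then (normalizedFactors f).count P * P.natDegree else 0

lemma sqful_le {k : ℕ} {f : F[X]} (hf : f ∈ monics F k) :
    sqful f ≤ 2 * ∑ d ∈ Finset.Icc 1 k, ∑ j ∈ Finset.Icc 2 k, ∑ P ∈ irreds F d,
      if P ^ j ∣ f then d else 0 := by
  rw [mem_monics] at hf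
  have hf0 := hf.1.ne_zero
  have hsub : ∑ P ∈ (normalizedFactors f).toFinset, ∑ j ∈ Finset.Icc 2 k,
      (if P ^ j ∣ f then P.natDegree else 0) ≤
      ∑ d ∈ Finset.Icc 1 k, ∑ P ∈ irreds F d, ∑ j ∈ Finset.Icc 2 k,
        if P ^ j ∣ f then d else 0 := by
    have : ∑ d ∈ Finset.Icc 1 k, ∑ P ∈ irreds F d, ∑ j ∈ Finset.Icc 2 k,
        (if P ^ j ∣ f then d else 0) = ∑ d ∈ Finset.Icc 1 k, ∑ P ∈ irreds F d,
          ∑ j ∈ Finset.Icc 2 k, (if P ^ j ∣ f then P.natDegree else 0) := by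
      refine Finset.sum_congr rfl fun d _ => Finset.sum_congr rfl fun P hP => ?_
      rw [(mem_irreds.1 hP).1.2]
    rw [this, ← Finset.sum_biUnion]
    · refine Finset.sum_le_sum_of_subset fun P hP => ?_
      rw [Multiset.mem_toFinset, mem_normalizedFactors_iff_of_monic hf0] at hP
      simp only [Finset.mem_biUnion, Finset.mem_Icc, mem_irreds]
      exact ⟨P.natDegree, ⟨hP.1.natDegree_pos, hf.2 ▸ natDegree_le_of_dvd hP.2.2 hf0⟩,
        ⟨hP.2.1, rfl⟩, hP.1⟩
    · intro d _ e _ hde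
      refine Finset.disjoint_left.2 fun P hP hQ => hde ?_
      rw [← (mem_irreds.1 hP).1.2, (mem_irreds.1 hQ).1.2]
  have hcomm : ∑ d ∈ Finset.Icc 1 k, ∑ j ∈ Finset.Icc 2 k, ∑ P ∈ irreds F d,
      (if P ^ j ∣ f then d else 0) = ∑ d ∈ Finset.Icc 1 k, ∑ P ∈ irreds F d,
        ∑ j ∈ Finset.Icc 2 k, if P ^ j ∣ f then d else 0 :=
    Finset.sum_congr rfl fun d _ => Finset.sum_comm
  rw [hcomm]
  refine le_trans ?_ (Nat.mul_le_mul_left 2 hsub)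
  rw [sqful, Finset.mul_sum]
  refine Finset.sum_le_sum fun P hP => ?_
  rw [Multiset.mem_toFinset, mem_normalizedFactors_iff_of_monic hf0] at hP
  split_ifs with h2
  · set v := (normalizedFactors f).count P
    have hd := (pow_dvd_iff_le_count_of_monic hP.1 hP.2.1 hf0 v).2 le_rfl
    have hdeg := natDegree_le_of_dvd hd hf0
    rw [hP.2.1.natDegree_pow, hf.2] at hdeg
    have hpos := hP.1.natDegree_pos
    have hvk : v ≤ k := le_trans (Nat.le_mul_of_pos_right v hpos) hdeg
    have hsum : ∑ j ∈ Finset.Icc 2 v, P.natDegree ≤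
        ∑ j ∈ Finset.Icc 2 k, (if P ^ j ∣ f then P.natDegree else 0) := by
      calc _ = ∑ j ∈ Finset.Icc 2 v, (if P ^ j ∣ f then P.natDegree else 0) := by
            refine Finset.sum_congr rfl fun j hj => ?_
            rw [if_pos]
            exact (pow_dvd_iff_le_count_of_monic hP.1 hP.2.1 hf0 j).2 (Finset.mem_Icc.1 hj).2
        _ ≤ _ := Finset.sum_le_sum_of_subset (Finset.Icc_subset_Icc_right hvk)
    rw [Finset.sum_const, Nat.card_Icc, smul_eq_mul] at hsum
    calc v * P.natDegree ≤ 2 * ((v + 1 - 2) * P.natDegree) := by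
          rw [← mul_assoc]; exact Nat.mul_le_mul_right _ (by omega)
      _ ≤ _ := Nat.mul_le_mul_left 2 hsum
  · exact Nat.zero_le _

lemma sum_Icc_inv_pow_le {q : ℝ} (hq : 2 ≤ q) (s : ℕ) : ∑ e ∈ Finset.Icc 1 s, (q ^ e)⁻¹ ≤ 1 := by
  have h : ∑ e ∈ Finset.Icc 1 s, (q ^ e)⁻¹ ≤ 1 - (q ^ s)⁻¹ := by
    induction s with
    | zero => simp
    | succ s ih =>
      rw [Finset.sum_Icc_succ_top (by omega)]
      have h0 : 0 < (q ^ s)⁻¹ := by positivity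
      have : (q ^ (s + 1))⁻¹ * q = (q ^ s)⁻¹ := by
        rw [pow_succ]; field_simp
      have h1 : 0 < (q ^ (s + 1))⁻¹ := by positivity
      nlinarith
  have : 0 < (q ^ s)⁻¹ := by positivity
  linarith

lemma sum_sqful_le (k : ℕ) :
    ∑ f ∈ monics F k, (sqful f : ℝ) ≤ 4 * (Fintype.card F : ℝ) ^ k := by
  have hq := two_le_card_field (F := F)
  set q : ℝ := (Fintype.card F : ℝ)
  have hq0 : 0 < q := by linarith
  calc ∑ f ∈ monics F k, (sqful f : ℝ)
      ≤ ∑ f ∈ monics F k, 2 * ∑ d ∈ Finset.Icc 1 k, ∑ j ∈ Finset.Icc 2 k, ∑ P ∈ irreds F d,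
          if P ^ j ∣ f then (d : ℝ) else 0 := by
        refine Finset.sum_le_sum fun f hf => ?_
        have := sqful_le hf
        calc (sqful f : ℝ) ≤ _ := Nat.cast_le.2 this
          _ = _ := by push_cast; rfl
    _ = 2 * ∑ d ∈ Finset.Icc 1 k, ∑ j ∈ Finset.Icc 2 k, ∑ P ∈ irreds F d,
          (d : ℝ) * ({f ∈ monics F k | P ^ j ∣ f}).card := by
        rw [← Finset.mul_sum, Finset.sum_comm]
        congr 1
        refine Finset.sum_congr rfl fun d _ => ?_
        rw [Finset.sum_comm]
        refine Finset.sum_congr rfl fun j _ => ?_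
        rw [Finset.sum_comm]
        refine Finset.sum_congr rfl fun P _ => ?_
        rw [← Finset.sum_filter, Finset.sum_const, nsmul_eq_mul, mul_comm]
    _ ≤ 2 * ∑ d ∈ Finset.Icc 1 k, ∑ j ∈ Finset.Icc 2 k,
          q ^ k * ((q ^ d) * (q ^ (d * j))⁻¹) := by
        gcongr with d hd j hj
        calc _ ≤ ∑ P ∈ irreds F d, (d : ℝ) * (q ^ k * (q ^ (d * j))⁻¹) := by
              gcongr with P hP
              exact card_monics_dvd_le (pow_mem_monics hP)
          _ = (d * (irreds F d).card) * (q ^ k * (q ^ (d * j))⁻¹) := by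
              rw [Finset.sum_const, nsmul_eq_mul]; ring
          _ ≤ q ^ d * (q ^ k * (q ^ (d * j))⁻¹) := by
              gcongr
              exact mul_card_irreds_le (by have := (Finset.mem_Icc.1 hd).1; omega)
          _ = _ := by ring
    _ ≤ 2 * ∑ d ∈ Finset.Icc 1 k, q ^ k * (2 * (q ^ d)⁻¹) := by
        gcongr with d hd
        rw [← Finset.mul_sum]
        gcongr
        have hd1 := (Finset.mem_Icc.1 hd).1
        have e : ∑ j ∈ Finset.Icc 2 k, q ^ d * (q ^ (d * j))⁻¹ ≤
            ∑ i ∈ Finset.Icc 1 k, ((q ^ d) ^ i)⁻¹ := by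
          calc _ = ∑ j ∈ Finset.Icc 2 k, ((q ^ d) ^ (j - 1))⁻¹ := by
                refine Finset.sum_congr rfl fun j hj => ?_
                have hj1 := (Finset.mem_Icc.1 hj).1
                rw [pow_mul, show (q ^ d) ^ j = q ^ d * (q ^ d) ^ (j - 1) by
                  rw [← pow_succ']; congr 1; omega]
                field_simp
            _ = ∑ i ∈ (Finset.Icc 2 k).image (fun j => j - 1), ((q ^ d) ^ i)⁻¹ := by
                rw [Finset.sum_image]
                intro a ha b hb hab
                simp only [Finset.coe_Icc, Set.mem_Icc] at ha hb hab
                omega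
            _ ≤ _ := by
                refine Finset.sum_le_sum_of_subset_of_nonneg ?_ fun _ _ _ => by positivity
                intro i hi
                simp only [Finset.mem_image, Finset.mem_Icc] at hi ⊢
                omega
        refine e.trans ?_
        have hqd : 2 ≤ q ^ d := by
          calc 2 ≤ q := hq
            _ = q ^ 1 := (pow_one q).symm
            _ ≤ q ^ d := pow_le_pow_right₀ (by linarith) hd1
        have e2 : ∀ s : ℕ, ∑ i ∈ Finset.Icc 1 s, ((q ^ d) ^ i)⁻¹ ≤
            (q ^ d)⁻¹ * (2 - 2 * ((q ^ d) ^ s)⁻¹) := by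
          intro s
          generalize q ^ d = Q at hqd
          have hQ0 : 0 < Q⁻¹ := by positivity
          have hQ1 : Q⁻¹ ≤ 1 / 2 := by
            rw [one_div]; exact inv_anti₀ (by norm_num) hqd
          induction s with
          | zero => simp
          | succ s ih =>
            rw [Finset.sum_Icc_succ_top (by omega), pow_succ, mul_inv]
            have h0 : 0 < (Q ^ s)⁻¹ := by positivity
            nlinarith [mul_pos h0 hQ0, mul_nonneg (mul_pos h0 hQ0).le (sub_nonneg.2 hQ1)]
        refine (e2 k).trans ?_
        rw [mul_comm]
        gcongr
        have : 0 < ((q ^ d) ^ k)⁻¹ := by positivity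
        linarith
    _ = 4 * q ^ k * ∑ d ∈ Finset.Icc 1 k, (q ^ d)⁻¹ := by
        rw [← Finset.mul_sum, ← Finset.mul_sum]; ring
    _ ≤ 4 * q ^ k * 1 := by
        gcongr
        exact sum_Icc_inv_pow_le hq k
    _ = _ := mul_one _

/-- Few monic polynomials have a large square-full part. -/
lemma card_lt_sqful_le (k K : ℕ) :
    (({f ∈ monics F k | K < sqful f}).card : ℝ) * (K + 1) ≤ 4 * (Fintype.card F : ℝ) ^ k := by
  refine le_trans ?_ (sum_sqful_le k)
  rw [← nsmul_eq_mul, ← Finset.sum_const]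
  calc _ ≤ ∑ f ∈ monics F k with K < sqful f, (sqful f : ℝ) := by
        refine Finset.sum_le_sum fun f hf => ?_
        have := (Finset.mem_filter.1 hf).2
        exact_mod_cast this
    _ ≤ _ := Finset.sum_le_sum_of_subset_of_nonneg (Finset.filter_subset _ _)
        fun _ _ _ => by positivity

lemma card_normalizedFactors_le (f : F[X]) : (normalizedFactors f).card ≤
    (normalizedFactors f).toFinset.card + sqful f := by
  rw [sqful, Finset.card_eq_sum_ones, ← Finset.sum_add_distrib, ← Multiset.toFinset_sum_count_eq]
  refine Finset.sum_le_sum fun P hP => ?_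
  have := (irreducible_of_normalized_factor P (Multiset.mem_toFinset.1 hP)).natDegree_pos
  split_ifs
  · nlinarith
  · omega

/-- Few monic polynomials have many distinct irreducible factors. -/
lemma card_lt_card_toFinset_le (k T : ℕ) :
    (({f ∈ monics F k | T < (normalizedFactors f).toFinset.card}).card : ℝ) ≤
      (2 / 3) ^ T * √(2 * k + 1) * (Fintype.card F : ℝ) ^ k := by
  have h := sum_monics_le_risingCoeff (F := F) (z := 3 / 2) (by norm_num)
    (fun f => (3 / 2) ^ (normalizedFactors f).toFinset.card) (by simp) (by
      intro P h hP hPm hh j _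
      rw [← pow_succ']
      refine pow_le_pow_right₀ (by norm_num) ?_
      rw [normalizedFactors_mul (pow_ne_zero _ hPm.ne_zero) hh.ne_zero,
        normalizedFactors_pow, normalizedFactors_irreducible hP, Multiset.toFinset_add]
      refine (Finset.card_union_le _ _).trans ?_
      rw [add_comm]
      gcongr
      refine (Finset.card_le_card (t := {normalize P}) ?_).trans (by simp)
      intro x hx
      rw [Multiset.mem_toFinset] at hx
      simpa using Multiset.mem_of_mem_nsmul hx) k
  have h2 : risingCoeff (3 / 2) k ≤ √(2 * k + 1) :=
    Real.le_sqrt_of_sq_le (risingCoeff_three_halves_le k)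
  have h3 : (({f ∈ monics F k | T < (normalizedFactors f).toFinset.card}).card : ℝ) *
      (3 / 2) ^ T ≤ ∑ f ∈ monics F k, (3 / 2 : ℝ) ^ (normalizedFactors f).toFinset.card := by
    rw [← nsmul_eq_mul, ← Finset.sum_const]
    calc _ ≤ ∑ f ∈ monics F k with T < (normalizedFactors f).toFinset.card,
          (3 / 2 : ℝ) ^ (normalizedFactors f).toFinset.card := by
          refine Finset.sum_le_sum fun f hf => ?_
          exact pow_le_pow_right₀ (by norm_num) (Finset.mem_filter.1 hf).2.le
      _ ≤ _ := Finset.sum_le_sum_of_subset_of_nonneg (Finset.filter_subset _ _)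
          fun _ _ _ => by positivity
  calc _ = (({f ∈ monics F k | T < (normalizedFactors f).toFinset.card}).card : ℝ) *
        (3 / 2) ^ T * (2 / 3) ^ T := by
        rw [mul_assoc, ← mul_pow]; norm_num
    _ ≤ ((Fintype.card F : ℝ) ^ k * √(2 * k + 1)) * (2 / 3) ^ T := by
        refine mul_le_mul_of_nonneg_right ((h3.trans h).trans ?_) (by positivity)
        gcongr
    _ = _ := by ring

/-- Few monic polynomials with a bounded number of prime factors have a divisor of a given
degree. -/
lemma card_exists_dvd_le (W : ℕ) {e k : ℕ} (he : e ≤ k) :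
    (({f ∈ monics F k | (normalizedFactors f).card ≤ W ∧ ∃ h ∈ monics F e, h ∣ f}).card : ℝ) ≤
      2 ^ W * (1 / √(2 * e + 1)) * (1 / √(2 * (k - e : ℕ) + 1)) * (Fintype.card F : ℝ) ^ k := by
  have hhalf : ∀ n : ℕ, ∑ f ∈ monics F n, (1 / 2 : ℝ) ^ (normalizedFactors f).card ≤
      (Fintype.card F : ℝ) ^ n * (1 / √(2 * n + 1)) := by
    intro n
    refine (sum_monics_le_risingCoeff (F := F) (z := 1 / 2) (by norm_num)
      (fun f => (1 / 2) ^ (normalizedFactors f).card) (by simp) ?_ n).trans ?_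
    · intro P h hP hPm hh j hj
      rw [← pow_succ', normalizedFactors_mul (pow_ne_zero _ hPm.ne_zero) hh.ne_zero,
        normalizedFactors_pow, normalizedFactors_irreducible hP]
      refine pow_le_pow_of_le_one (by norm_num) (by norm_num) ?_
      simp
      omega
    · gcongr
      rw [le_div_iff₀ (by positivity)]
      have h1 := risingCoeff_half_le n
      have h2 : 0 ≤ risingCoeff (1 / 2) n * √(2 * n + 1) := by
        have := risingCoeff_nonneg (z := 1 / 2) (by norm_num) n
        positivity
      refine (sq_le_one_iff₀ h2).1 ?_
      rw [mul_pow, Real.sq_sqrt (by positivity)]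
      exact h1
  have hsub : {f ∈ monics F k | (normalizedFactors f).card ≤ W ∧ ∃ h ∈ monics F e, h ∣ f} ⊆
      ({z ∈ monics F e ×ˢ monics F (k - e) | (normalizedFactors (z.1 * z.2)).card ≤ W}).image
        (fun z => z.1 * z.2) := by
    intro f hf
    simp only [Finset.mem_filter, mem_monics] at hf
    obtain ⟨⟨hf1, hf2⟩, hW, h, ⟨hh1, hh2⟩, c, rfl⟩ := hf
    have hc : c.Monic := hh1.of_mul_monic_left hf1
    rw [hh1.natDegree_mul hc] at hf2
    have hce : c.natDegree = k - e := by omega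
    simp only [Finset.mem_image, Finset.mem_filter, Finset.mem_product, mem_monics]
    exact ⟨(h, c), ⟨⟨⟨hh1, hh2⟩, hc, hce⟩, hW⟩, rfl⟩
  have hcard := (Finset.card_le_card hsub).trans Finset.card_image_le
  calc _ ≤ (({z ∈ monics F e ×ˢ monics F (k - e) |
        (normalizedFactors (z.1 * z.2)).card ≤ W}).card : ℝ) := Nat.cast_le.2 hcard
    _ = ∑ z ∈ monics F e ×ˢ monics F (k - e) with (normalizedFactors (z.1 * z.2)).card ≤ W,
          (1 : ℝ) := by simp
    _ ≤ ∑ z ∈ monics F e ×ˢ monics F (k - e) with (normalizedFactors (z.1 * z.2)).card ≤ W,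
          (2 : ℝ) ^ W * ((1 / 2) ^ (normalizedFactors z.1).card *
            (1 / 2) ^ (normalizedFactors z.2).card) := by
        refine Finset.sum_le_sum fun z hz => ?_
        simp only [Finset.mem_filter, Finset.mem_product, mem_monics] at hz
        rw [← pow_add, ← Multiset.card_add,
          ← normalizedFactors_mul hz.1.1.1.ne_zero hz.1.2.1.ne_zero]
        calc (1 : ℝ) = 2 ^ W * (1 / 2) ^ W := by rw [← mul_pow]; norm_num
          _ ≤ _ := by
            refine mul_le_mul_of_nonneg_left ?_ (by positivity)
            exact pow_le_pow_of_le_one (by norm_num) (by norm_num) hz.2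
    _ ≤ ∑ z ∈ monics F e ×ˢ monics F (k - e), (2 : ℝ) ^ W *
          ((1 / 2) ^ (normalizedFactors z.1).card * (1 / 2) ^ (normalizedFactors z.2).card) :=
        Finset.sum_le_sum_of_subset_of_nonneg (Finset.filter_subset _ _)
          fun _ _ _ => by positivity
    _ = 2 ^ W * ((∑ f ∈ monics F e, (1 / 2 : ℝ) ^ (normalizedFactors f).card) *
          ∑ f ∈ monics F (k - e), (1 / 2 : ℝ) ^ (normalizedFactors f).card) := by
        rw [← Finset.mul_sum, Finset.sum_mul_sum, Finset.sum_product]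
    _ ≤ 2 ^ W * (((Fintype.card F : ℝ) ^ e * (1 / √(2 * e + 1))) *
          ((Fintype.card F : ℝ) ^ (k - e) * (1 / √(2 * (k - e : ℕ) + 1)))) := by
        gcongr
        · exact hhalf e
        · exact hhalf (k - e)
    _ = _ := by
        rw [show (Fintype.card F : ℝ) ^ k = Fintype.card F ^ e * Fintype.card F ^ (k - e) by
          rw [← pow_add]; congr 1; omega]
        ring

end TypicalFactorization

section TypicalDegrees

open Polynomial UniqueFactorizationMonoid

variable {F : Type*} [Field F] [Fintype F]

lemma mul_dvd_of_monic_irreducible_ne {P Q f : F[X]} (hP : Irreducible P) (hPm : P.Monic)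
    (hQ : Irreducible Q) (hQm : Q.Monic) (hne : P ≠ Q) : P * Q ∣ f ↔ P ∣ f ∧ Q ∣ f := by
  constructor
  · intro h
    exact ⟨(dvd_mul_right P Q).trans h, (dvd_mul_left Q P).trans h⟩
  · rintro ⟨h1, h2⟩
    refine IsCoprime.mul_dvd ((hP.coprime_iff_not_dvd).2 fun h => hne ?_) h1 h2
    exact eq_of_monic_of_associated hPm hQm (hP.associated_of_dvd hQ h)

lemma mul_mem_monics {d e : ℕ} {P Q : F[X]} (hP : P ∈ monics F d) (hQ : Q ∈ monics F e) :
    P * Q ∈ monics F (d + e) := by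
  rw [mem_monics] at *
  exact ⟨hP.1.mul hQ.1, by rw [hP.1.natDegree_mul hQ.1, hP.2, hQ.2]⟩

lemma card_irreds_mul_inv_le {d : ℕ} (hd : d ≠ 0) :
    (irreds F d).card * ((Fintype.card F : ℝ) ^ d)⁻¹ ≤ (d : ℝ)⁻¹ := by
  have hq := two_le_card_field (F := F)
  have hd' : (0 : ℝ) < d := by exact_mod_cast Nat.pos_of_ne_zero hd
  rw [← div_eq_mul_inv, ← one_div, div_le_div_iff₀ (by positivity) hd', one_mul, mul_comm]
  exact mul_card_irreds_le hd

lemma sum_filter_dvd_inv_le {m k : ℕ} (hm : m ≠ 0) :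
    ∑ d ∈ Finset.Icc 1 k with m ∣ d, (d : ℝ)⁻¹ ≤
      (m : ℝ)⁻¹ * ∑ d ∈ Finset.Icc 1 k, (d : ℝ)⁻¹ := by
  have hsub : {d ∈ Finset.Icc 1 k | m ∣ d} ⊆ (Finset.Icc 1 k).image (fun d => m * d) := by
    intro d hd
    simp only [Finset.mem_filter, Finset.mem_Icc, Finset.mem_image] at hd ⊢
    obtain ⟨⟨h1, h2⟩, c, rfl⟩ := hd
    have hc : c ≠ 0 := by rintro rfl; omega
    exact ⟨c, ⟨by omega, le_trans (Nat.le_mul_of_pos_left c (by omega)) h2⟩, rfl⟩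
  refine (Finset.sum_le_sum_of_subset_of_nonneg hsub fun _ _ _ => by positivity).trans ?_
  rw [Finset.sum_image fun a _ b _ hab => Nat.eq_of_mul_eq_mul_left (by omega) hab,
    Finset.mul_sum]
  refine le_of_eq (Finset.sum_congr rfl fun d _ => ?_)
  push_cast
  rw [mul_inv]

/-- `f` has two distinct monic prime factors whose degrees have a common divisor `m ≥ y`. -/
def HasCommonDegreeDivisor (y : ℕ) (f : F[X]) : Prop :=
  ∃ m P Q, y ≤ m ∧ P ≠ Q ∧ Irreducible P ∧ P.Monic ∧ P ∣ f ∧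
    Irreducible Q ∧ Q.Monic ∧ Q ∣ f ∧ m ∣ P.natDegree ∧ m ∣ Q.natDegree

/-- Few monic polynomials have two prime factors whose degrees have a large common divisor. -/
lemma card_common_divisor_le {y : ℕ} (hy : 1 ≤ y) (k : ℕ) :
    (({f ∈ monics F k | HasCommonDegreeDivisor y f}).card : ℝ) ≤
      2 * (∑ d ∈ Finset.Icc 1 k, (d : ℝ)⁻¹) ^ 2 / y * (Fintype.card F : ℝ) ^ k := by
  have hq := two_le_card_field (F := F)
  set q : ℝ := (Fintype.card F : ℝ)
  have hq0 : 0 < q := by linarith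
  set H : ℝ := ∑ d ∈ Finset.Icc 1 k, (d : ℝ)⁻¹
  set A : ℕ → Finset ℕ := fun m => {d ∈ Finset.Icc 1 k | m ∣ d}
  have hsub : {f ∈ monics F k | HasCommonDegreeDivisor y f} ⊆
      (Finset.Icc y k).biUnion fun m => (A m).biUnion fun d => (A m).biUnion fun e =>
        (irreds F d).biUnion fun P => (irreds F e).biUnion fun Q =>
          {f ∈ monics F k | P ≠ Q ∧ P * Q ∣ f} := by
    intro f hf
    rw [Finset.mem_filter] at hf
    obtain ⟨hfm, m, P, Q, hm, hne, hP, hPm, hPf, hQ, hQm, hQf, hmP, hmQ⟩ := hf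
    have hf' := mem_monics.1 hfm
    have hPk := natDegree_le_of_dvd hPf hf'.1.ne_zero
    have hQk := natDegree_le_of_dvd hQf hf'.1.ne_zero
    rw [hf'.2] at hPk hQk
    have hPp := hP.natDegree_pos
    have hQp := hQ.natDegree_pos
    have hmk := Nat.le_of_dvd hPp hmP
    simp only [Finset.mem_biUnion, Finset.mem_filter, A, Finset.mem_Icc, mem_irreds]
    exact ⟨m, ⟨hm, by omega⟩, P.natDegree, ⟨⟨hPp, hPk⟩, hmP⟩, Q.natDegree, ⟨⟨hQp, hQk⟩, hmQ⟩, P,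
      ⟨⟨hPm, rfl⟩, hP⟩, Q, ⟨⟨hQm, rfl⟩, hQ⟩, hfm, hne,
      (mul_dvd_of_monic_irreducible_ne hP hPm hQ hQm hne).2 ⟨hPf, hQf⟩⟩
  have hA : ∀ m ∈ Finset.Icc y k, ∑ d ∈ A m, (d : ℝ)⁻¹ ≤ (m : ℝ)⁻¹ * H := fun m hm =>
    sum_filter_dvd_inv_le (by have := (Finset.mem_Icc.1 hm).1; omega)
  calc _ ≤ ∑ m ∈ Finset.Icc y k, ∑ d ∈ A m, ∑ e ∈ A m, ∑ P ∈ irreds F d, ∑ Q ∈ irreds F e,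
        (({f ∈ monics F k | P ≠ Q ∧ P * Q ∣ f}).card : ℝ) := by
        refine (Nat.cast_le.2 (Finset.card_le_card hsub)).trans ?_
        simp only [← Nat.cast_sum]
        refine Nat.cast_le.2 ?_
        refine Finset.card_biUnion_le.trans (Finset.sum_le_sum fun m _ => ?_)
        refine Finset.card_biUnion_le.trans (Finset.sum_le_sum fun d _ => ?_)
        refine Finset.card_biUnion_le.trans (Finset.sum_le_sum fun e _ => ?_)
        refine Finset.card_biUnion_le.trans (Finset.sum_le_sum fun P _ => ?_)
        exact Finset.card_biUnion_le
    _ ≤ ∑ m ∈ Finset.Icc y k, ∑ d ∈ A m, ∑ e ∈ A m, ∑ P ∈ irreds F d, ∑ Q ∈ irreds F e,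
        q ^ k * ((q ^ d)⁻¹ * (q ^ e)⁻¹) := by
        gcongr with m hm d hd e he P hP Q hQ
        rw [← mul_inv, ← pow_add]
        refine le_trans ?_ (card_monics_dvd_le (mul_mem_monics (Finset.mem_filter.1 hP).1
          (Finset.mem_filter.1 hQ).1))
        refine Nat.cast_le.2 (Finset.card_le_card fun f hf => ?_)
        rw [Finset.mem_filter] at hf ⊢
        exact ⟨hf.1, hf.2.2⟩
    _ = q ^ k * ∑ m ∈ Finset.Icc y k, (∑ d ∈ A m, (irreds F d).card * (q ^ d)⁻¹) ^ 2 := by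
        rw [Finset.mul_sum]
        refine Finset.sum_congr rfl fun m _ => ?_
        rw [sq, Finset.sum_mul_sum, Finset.mul_sum]
        refine Finset.sum_congr rfl fun d _ => ?_
        rw [Finset.mul_sum]
        refine Finset.sum_congr rfl fun e _ => ?_
        simp only [Finset.sum_const, nsmul_eq_mul]
        ring
    _ ≤ q ^ k * ∑ m ∈ Finset.Icc y k, ((m : ℝ)⁻¹ * H) ^ 2 := by
        refine mul_le_mul_of_nonneg_left (Finset.sum_le_sum fun m hm => ?_) (by positivity)
        refine pow_le_pow_left₀ (Finset.sum_nonneg fun d _ => by positivity) ?_ 2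
        refine le_trans (Finset.sum_le_sum fun d hd => ?_) (hA m hm)
        refine card_irreds_mul_inv_le ?_
        have := Finset.mem_Icc.1 (Finset.mem_filter.1 hd).1
        omega
    _ = q ^ k * H ^ 2 * ∑ m ∈ Finset.Ioo (y - 1) (k + 1), ((m : ℝ) ^ 2)⁻¹ := by
        have : Finset.Icc y k = Finset.Ioo (y - 1) (k + 1) := by
          ext; simp; omega
        rw [this, mul_assoc, Finset.mul_sum _ _ (H ^ 2)]
        congr 1
        refine Finset.sum_congr rfl fun m _ => ?_
        rw [mul_pow, inv_pow]; ring
    _ ≤ q ^ k * H ^ 2 * (2 / ((y - 1 : ℕ) + 1)) := by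
        gcongr
        exact sum_Ioo_inv_sq_le _ _
    _ = _ := by
        rw [← Nat.cast_add_one, Nat.sub_add_cancel hy]
        ring

/-- Second moment bound: if the expected number of divisors from a set of primes is large, few
polynomials have at most one such divisor. -/
lemma card_at_most_one_dvd_le {k : ℕ} (S : Finset F[X])
    (hS : ∀ P ∈ S, Irreducible P ∧ P.Monic ∧ 2 * P.natDegree ≤ k) {E : ℝ}
    (hE : E = ∑ P ∈ S, ((Fintype.card F : ℝ) ^ P.natDegree)⁻¹) (h2 : 2 ≤ E) :
    (({f ∈ monics F k | ({P ∈ S | P ∣ f}).card ≤ 1}).card : ℝ) ≤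
      4 / E * (Fintype.card F : ℝ) ^ k := by
  have hq := two_le_card_field (F := F)
  set q : ℝ := (Fintype.card F : ℝ)
  have hq0 : 0 < q := by linarith
  set cnt : F[X] → ℝ := fun f => ∑ P ∈ S, if P ∣ f then 1 else 0
  have hcard : ∀ P ∈ S, (({f ∈ monics F k | P ∣ f}).card : ℝ) =
      q ^ k * (q ^ P.natDegree)⁻¹ := by
    intro P hP
    obtain ⟨h1, h2, h3⟩ := hS P hP
    rw [card_monics_dvd (by omega) (mem_monics.2 ⟨h2, rfl⟩)]
    push_cast
    exact pow_sub₀ _ hq0.ne' (by omega)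
  have hX1 : ∑ f ∈ monics F k, cnt f = q ^ k * E := by
    rw [Finset.sum_comm, hE, Finset.mul_sum]
    refine Finset.sum_congr rfl fun P hP => ?_
    rw [← hcard P hP, ← Finset.sum_filter]; simp
  have hX2 : ∑ f ∈ monics F k, cnt f ^ 2 ≤ q ^ k * (E + E ^ 2) := by
    calc ∑ f ∈ monics F k, cnt f ^ 2 = ∑ P ∈ S, ∑ Q ∈ S,
          (({f ∈ monics F k | P ∣ f ∧ Q ∣ f}).card : ℝ) := by
          simp_rw [cnt, sq, Finset.sum_mul_sum]
          rw [Finset.sum_comm]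
          refine Finset.sum_congr rfl fun P _ => ?_
          rw [Finset.sum_comm]
          refine Finset.sum_congr rfl fun Q _ => ?_
          rw [Finset.card_filter]
          push_cast
          refine Finset.sum_congr rfl fun f _ => ?_
          by_cases h1 : P ∣ f <;> by_cases h2 : Q ∣ f <;> simp [h1, h2]
      _ ≤ ∑ P ∈ S, ∑ Q ∈ S, ((if P = Q then q ^ k * (q ^ P.natDegree)⁻¹ else 0) +
            q ^ k * ((q ^ P.natDegree)⁻¹ * (q ^ Q.natDegree)⁻¹)) := by
          refine Finset.sum_le_sum fun P hP => Finset.sum_le_sum fun Q hQ => ?_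
          split_ifs with h
          · subst h
            simp only [and_self]
            rw [hcard P hP]
            exact le_add_of_nonneg_right (by positivity)
          · rw [zero_add, ← mul_inv, ← pow_add]
            obtain ⟨h1, h2, h3⟩ := hS P hP
            obtain ⟨h4, h5, h6⟩ := hS Q hQ
            refine le_trans ?_ (card_monics_dvd_le (mul_mem_monics
              (mem_monics.2 ⟨h2, rfl⟩) (mem_monics.2 ⟨h5, rfl⟩)))
            refine Nat.cast_le.2 (Finset.card_le_card fun f hf => ?_)
            rw [Finset.mem_filter] at hf ⊢
            exact ⟨hf.1, (mul_dvd_of_monic_irreducible_ne h1 h2 h4 h5 h).2 hf.2⟩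
      _ = _ := by
          simp_rw [Finset.sum_add_distrib]
          rw [hE, sq, Finset.sum_mul_sum, mul_add]
          congr 1
          · rw [Finset.mul_sum]
            refine Finset.sum_congr rfl fun P hP => ?_
            simp [hP]
          · simp_rw [Finset.mul_sum]
  have hvar : ∑ f ∈ monics F k, (cnt f - E) ^ 2 ≤ q ^ k * E := by
    have : ∑ f ∈ monics F k, (cnt f - E) ^ 2 = ∑ f ∈ monics F k, cnt f ^ 2 -
        2 * E * ∑ f ∈ monics F k, cnt f + q ^ k * E ^ 2 := by
      rw [Finset.mul_sum, ← Finset.sum_sub_distrib]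
      have h3 : q ^ k * E ^ 2 = ∑ f ∈ monics F k, E ^ 2 := by
        rw [Finset.sum_const, card_monics, nsmul_eq_mul]; push_cast; rfl
      rw [h3, ← Finset.sum_add_distrib]
      exact Finset.sum_congr rfl fun f _ => by ring
    rw [this, hX1]
    nlinarith
  have hlow : (({f ∈ monics F k | ({P ∈ S | P ∣ f}).card ≤ 1}).card : ℝ) * (E ^ 2 / 4) ≤
      q ^ k * E := by
    refine le_trans ?_ hvar
    rw [← nsmul_eq_mul, ← Finset.sum_const]
    calc _ ≤ ∑ f ∈ monics F k with ({P ∈ S | P ∣ f}).card ≤ 1, (cnt f - E) ^ 2 := by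
          refine Finset.sum_le_sum fun f hf => ?_
          have h3 : cnt f ≤ 1 := by
            have := (Finset.mem_filter.1 hf).2
            simp only [cnt]
            rw [← Finset.sum_filter]
            simpa using this
          nlinarith
      _ ≤ _ := Finset.sum_le_sum_of_subset_of_nonneg (Finset.filter_subset _ _)
          fun _ _ _ => by positivity
  have hE0 : 0 < E := by linarith
  rw [div_mul_eq_mul_div, le_div_iff₀ hE0]
  have : (({f ∈ monics F k | ({P ∈ S | P ∣ f}).card ≤ 1}).card : ℝ) * E * E ≤
      4 * q ^ k * E := by nlinarith
  exact le_of_mul_le_mul_right this hE0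

/-- Most monic polynomials have two prime factors with degrees in a set of large logarithmic
size. -/
lemma card_not_two_factors_le {k : ℕ} (D : Finset ℕ) (hD : ∀ d ∈ D, 3 ≤ d ∧ 2 * d ≤ k) {E : ℝ}
    (h2 : 2 ≤ E) (hE : E ≤ ∑ d ∈ D, (2 * d : ℝ)⁻¹) :
    (({f ∈ monics F k | ¬ ∃ P Q : F[X], P ≠ Q ∧ (Irreducible P ∧ P.Monic ∧ P ∣ f) ∧
      (Irreducible Q ∧ Q.Monic ∧ Q ∣ f) ∧ P.natDegree ∈ D ∧ Q.natDegree ∈ D}).card : ℝ) ≤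
      4 / E * (Fintype.card F : ℝ) ^ k := by
  have hq := two_le_card_field (F := F)
  have hdisj : (D : Set ℕ).PairwiseDisjoint (irreds F) := by
    intro d _ e _ hde
    refine Finset.disjoint_left.2 fun P hP hQ => hde ?_
    rw [← (mem_irreds.1 hP).1.2, (mem_irreds.1 hQ).1.2]
  have hE' : E ≤ ∑ P ∈ D.biUnion (irreds F), ((Fintype.card F : ℝ) ^ P.natDegree)⁻¹ := by
    refine hE.trans ?_
    rw [Finset.sum_biUnion hdisj]
    refine Finset.sum_le_sum fun d hd => ?_
    have h3 := (hD d hd).1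
    have h4 := le_mul_card_irreds (F := F) h3
    have hd0 : (0 : ℝ) < d := by exact_mod_cast (by omega : 0 < d)
    calc (2 * d : ℝ)⁻¹ ≤ (irreds F d).card * ((Fintype.card F : ℝ) ^ d)⁻¹ := by
          rw [← div_eq_mul_inv, ← one_div, div_le_div_iff₀ (by positivity) (by positivity)]
          linarith
      _ = ∑ P ∈ irreds F d, ((Fintype.card F : ℝ) ^ d)⁻¹ := by
          rw [Finset.sum_const, nsmul_eq_mul]
      _ = _ := Finset.sum_congr rfl fun P hP => by rw [(mem_irreds.1 hP).1.2]
  refine le_trans ?_ ((card_at_most_one_dvd_le (F := F) (k := k) (D.biUnion (irreds F)) ?_ rfl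
    (h2.trans hE')).trans ?_)
  · refine Nat.cast_le.2 (Finset.card_le_card fun f hf => ?_)
    rw [Finset.mem_filter] at hf ⊢
    refine ⟨hf.1, ?_⟩
    by_contra! hcon
    obtain ⟨P, hP, Q, hQ, hne⟩ := Finset.one_lt_card.1 hcon
    simp only [Finset.mem_filter, Finset.mem_biUnion, mem_irreds] at hP hQ
    obtain ⟨⟨d, hd, ⟨hPm, hPd⟩, hPi⟩, hPf⟩ := hP
    obtain ⟨⟨e, he, ⟨hQm, hQd⟩, hQi⟩, hQf⟩ := hQ
    exact hf.2 ⟨P, Q, hne, ⟨hPi, hPm, hPf⟩, ⟨hQi, hQm, hQf⟩, hPd ▸ hd, hQd ▸ he⟩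
  · intro P hP
    simp only [Finset.mem_biUnion, mem_irreds] at hP
    obtain ⟨d, hd, ⟨hPm, hPd⟩, hPi⟩ := hP
    exact ⟨hPi, hPm, hPd ▸ (hD d hd).2⟩
  · gcongr

end TypicalDegrees

section PrimeReciprocals

open Filter Topology

/-- A Chebyshev-type lower bound for the primes in `(4 ^ i, 4 ^ (i + 1)]`. -/
lemma eventually_le_sum_primes_block : ∀ᶠ i : ℕ in atTop, (1 / (8 * (i + 1 : ℕ)) : ℝ) ≤
    ∑ l ∈ Finset.Ioc (4 ^ i : ℕ) (4 ^ (i + 1)) with l.Prime, (l : ℝ)⁻¹ := by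
  have hlog2 : 0 < Real.log 2 := Real.log_pos (by norm_num)
  have hlog4 : Real.log 4 = 2 * Real.log 2 := by
    rw [show (4 : ℝ) = 2 ^ 2 by norm_num, Real.log_pow]; norm_num
  have h1 : ∀ᶠ x : ℝ in atTop, Real.log (x + 1) ≤ (Real.log 2 / 8) * x := by
    have h := (Real.isLittleO_log_id_atTop.comp_tendsto
      (tendsto_atTop_add_const_right atTop (1 : ℝ) tendsto_id)).bound
      (show 0 < Real.log 2 / 16 by positivity)
    filter_upwards [h, eventually_ge_atTop 1] with x hx hx1
    simp only [Function.comp, id, Real.norm_eq_abs] at hx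
    rw [abs_of_nonneg (Real.log_nonneg (by linarith)), abs_of_nonneg (by linarith)] at hx
    nlinarith
  have h2 : ∀ᶠ x : ℝ in atTop, 2 * √x * Real.log x ≤ (Real.log 2 / 8) * x := by
    have h := (isLittleO_log_rpow_atTop (r := 1 / 2) (by norm_num)).bound
      (show 0 < Real.log 2 / 16 by positivity)
    filter_upwards [h, eventually_ge_atTop 1] with x hx hx1
    rw [← Real.sqrt_eq_rpow, Real.norm_eq_abs, Real.norm_eq_abs,
      abs_of_nonneg (Real.log_nonneg hx1), abs_of_nonneg (Real.sqrt_nonneg x)] at hx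
    have h3 := Real.mul_self_sqrt (show 0 ≤ x by linarith)
    have h4 := mul_le_mul_of_nonneg_left hx (Real.sqrt_nonneg x)
    nlinarith
  have hcast : Tendsto (fun i : ℕ => ((4 ^ (i + 1) : ℕ) : ℝ)) atTop atTop :=
    tendsto_natCast_atTop_atTop.comp
      ((tendsto_pow_atTop_atTop_of_one_lt (by norm_num : 1 < 4)).comp (tendsto_add_atTop_nat 1))
  filter_upwards [hcast.eventually h1, hcast.eventually h2] with i hi1 hi2
  have hge := Chebyshev.theta_ge (4 ^ (i + 1))
  have hle := Chebyshev.theta_le_log4_mul_x (x := ((4 ^ i : ℕ) : ℝ)) (by positivity)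
  have hsplit : Chebyshev.theta ((4 ^ (i + 1) : ℕ) : ℝ) - Chebyshev.theta ((4 ^ i : ℕ) : ℝ) =
      ∑ l ∈ Finset.Ioc (4 ^ i : ℕ) (4 ^ (i + 1)) with l.Prime, Real.log l := by
    rw [sub_eq_iff_eq_add', Chebyshev.theta, Chebyshev.theta, Nat.floor_natCast,
      Nat.floor_natCast, ← Finset.sum_union]
    · congr 1
      rw [← Finset.filter_union, Finset.Ioc_union_Ioc_eq_Ioc (Nat.zero_le _)
        (Nat.pow_le_pow_right (by norm_num) (Nat.le_succ i))]
    · refine Finset.disjoint_left.2 fun l hl hl' => ?_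
      simp only [Finset.mem_filter, Finset.mem_Ioc] at hl hl'
      omega
  have hlow : (4 : ℝ) ^ i * Real.log 2 ≤
      ∑ l ∈ Finset.Ioc (4 ^ i : ℕ) (4 ^ (i + 1)) with l.Prime, Real.log l := by
    rw [← hsplit]
    push_cast at *
    rw [hlog4] at hle
    have h4 : (4 : ℝ) ^ (i + 1) = 4 * 4 ^ i := pow_succ' 4 i
    rw [h4] at hge hi1 hi2 ⊢
    linarith
  have hup : ∑ l ∈ Finset.Ioc (4 ^ i : ℕ) (4 ^ (i + 1)) with l.Prime, Real.log l ≤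
      (4 ^ (i + 1) * ((i + 1 : ℕ) * Real.log 4)) *
        ∑ l ∈ Finset.Ioc (4 ^ i : ℕ) (4 ^ (i + 1)) with l.Prime, (l : ℝ)⁻¹ := by
    rw [Finset.mul_sum]
    refine Finset.sum_le_sum fun l hl => ?_
    simp only [Finset.mem_filter, Finset.mem_Ioc] at hl
    have hl0 : (0 : ℝ) < l := by exact_mod_cast hl.2.pos
    have hl4 : (l : ℝ) ≤ 4 ^ (i + 1) := by exact_mod_cast hl.1.2
    rw [← div_eq_mul_inv, le_div_iff₀ hl0, mul_comm]
    have : Real.log l ≤ (i + 1 : ℕ) * Real.log 4 := by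
      rw [← Real.log_pow]
      exact Real.log_le_log hl0 hl4
    exact mul_le_mul hl4 this (Real.log_nonneg (by exact_mod_cast hl.2.one_lt.le)) (by positivity)
  have h5 := hlow.trans hup
  rw [hlog4, pow_succ'] at h5
  rw [div_le_iff₀ (by positivity)]
  have h6 : (0 : ℝ) < 4 ^ i * Real.log 2 := by positivity
  refine le_of_mul_le_mul_left ?_ h6
  rw [mul_one]
  refine h5.trans (le_of_eq ?_)
  ring

lemma harmonic_sub_ge {A B : ℕ} (hA : 1 ≤ A) (hAB : A ≤ B) :
    Real.log ((B + 1) / A) - 1 ≤ ∑ d ∈ Finset.Ioc A B, (d : ℝ)⁻¹ := by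
  have h1 := log_add_one_le_harmonic B
  have h2 := harmonic_le_one_add_log A
  have h3 : ∀ m : ℕ, ((harmonic m : ℚ) : ℝ) = ∑ d ∈ Finset.Ioc 0 m, (d : ℝ)⁻¹ := by
    intro m
    rw [harmonic_eq_sum_Icc]
    push_cast
    rfl
  rw [h3] at h1 h2
  rw [← Finset.Ioc_union_Ioc_eq_Ioc (Nat.zero_le A) hAB, Finset.sum_union] at h1
  · have hA' : (0 : ℝ) < A := by exact_mod_cast hA
    rw [Real.log_div (by positivity) hA'.ne']
    push_cast at h1
    linarith
  · refine Finset.disjoint_left.2 fun l hl hl' => ?_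
    simp only [Finset.mem_Ioc] at hl hl'
    omega

lemma exists_le_sum_primes_inv : ∃ I : ℕ, ∀ A B : ℕ, I ≤ A → 1 ≤ A → A ≤ B →
    (Real.log ((B + 1) / A) - 1) / 8 ≤
      ∑ l ∈ Finset.Ioc (4 ^ A : ℕ) (4 ^ B) with l.Prime, (l : ℝ)⁻¹ := by
  obtain ⟨I, hI⟩ := eventually_atTop.1 eventually_le_sum_primes_block
  refine ⟨I, fun A B hIA hA hAB => ?_⟩
  have key : ∀ B, A ≤ B → (∑ d ∈ Finset.Ioc A B, (d : ℝ)⁻¹) / 8 ≤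
      ∑ l ∈ Finset.Ioc (4 ^ A : ℕ) (4 ^ B) with l.Prime, (l : ℝ)⁻¹ := by
    intro B hB
    induction B, hB using Nat.le_induction with
    | base => simp
    | succ B hB ih =>
      have h1 := hI B (hIA.trans hB)
      have h2 : Finset.Ioc A (B + 1) = insert (B + 1) (Finset.Ioc A B) := by
        ext; simp; omega
      rw [h2, Finset.sum_insert (by simp), ← Finset.Ioc_union_Ioc_eq_Ioc
        (Nat.pow_le_pow_right (by norm_num) hB)
        (Nat.pow_le_pow_right (by norm_num) (Nat.le_succ B)), Finset.filter_union,
        Finset.sum_union]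
      · have h3 : (1 / (8 * (B + 1 : ℕ)) : ℝ) = ((B + 1 : ℕ) : ℝ)⁻¹ / 8 := by
          rw [one_div, mul_inv]; ring
        rw [h3] at h1
        rw [add_div]
        linarith
      · refine Finset.disjoint_left.2 fun l hl hl' => ?_
        simp only [Finset.mem_filter, Finset.mem_Ioc] at hl hl'
        omega
  refine le_trans ?_ (key B hAB)
  gcongr
  exact harmonic_sub_ge hA hAB

end PrimeReciprocals

section IsTypical

open Polynomial UniqueFactorizationMonoid

variable {F : Type*} [Field F]

/-- The factorization properties, satisfied by most polynomials of degree close to `n`, which force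
a transitive group containing a permutation with a matching cycle type to be large. -/
structure IsTypical (n K L y R N : ℕ) (f : F[X]) : Prop where
  sqful_le : sqful f ≤ K
  natDegree_ne : ∀ r t (h : F[X]), 2 ≤ r → r ≤ R → t ≤ L → h.Monic → h ∣ f →
    (h.natDegree + t) * r ≠ n
  not_common : ¬ HasCommonDegreeDivisor y f
  exists_prime : ∃ P : F[X], Irreducible P ∧ P.Monic ∧ P ∣ f ∧ P.natDegree.Prime ∧
    y ≤ P.natDegree ∧ 2 * P.natDegree ≤ n
  exists_two : ∃ P Q : F[X], P ≠ Q ∧ (Irreducible P ∧ P.Monic ∧ P ∣ f) ∧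
    (Irreducible Q ∧ Q.Monic ∧ Q ∣ f) ∧ N ≤ P.natDegree ∧ N ≤ Q.natDegree

variable [Fintype F]

lemma one_div_sqrt_mul_le {n k L L' y r t : ℕ} (hk : n ≤ k + L) (hL : 4 * L < n)
    (hy : 1 ≤ y) (hn : y ^ 2 * (2 * L' + 1) ≤ n) (hr : 2 ≤ r) (hrR : r ≤ y ^ 2) (ht : t ≤ L') :
    n / r - t ≤ k ∧
    (1 / √(2 * (n / r - t : ℕ) + 1)) * (1 / √(2 * (k - (n / r - t) : ℕ) + 1)) ≤ 2 * y / (n : ℝ) := by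
  have hr2 : n / r ≤ n / 2 := Nat.div_le_div_left hr (by norm_num)
  have h1 : n < r * (n / r + 1) := Nat.lt_mul_div_succ n (by omega)
  have h2 : r * (n / r + 1) ≤ y ^ 2 * ((n / r - t) + L' + 1) :=
    Nat.mul_le_mul hrR (by omega)
  have h4 : n / r - t ≤ n / 2 := (Nat.sub_le _ _).trans hr2
  generalize n / r - t = e at *
  have h3 : n ≤ y ^ 2 * (2 * e + 1) := by nlinarith
  have h5 : n ≤ 4 * (2 * (k - e) + 1) := by omega
  have hn0 : (0 : ℝ) < n := by exact_mod_cast (by omega : 0 < n)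
  refine ⟨by omega, ?_⟩
  have h3' : √(n : ℝ) ≤ y * √(2 * e + 1) := by
    rw [← Real.sqrt_sq (show (0 : ℝ) ≤ y by positivity), ← Real.sqrt_mul (by positivity)]
    exact Real.sqrt_le_sqrt (by exact_mod_cast h3)
  have h5' : √(n : ℝ) ≤ 2 * √(2 * (k - e : ℕ) + 1) := by
    rw [show (2 : ℝ) = √(2 ^ 2) by rw [Real.sqrt_sq (by norm_num)],
      ← Real.sqrt_mul (by positivity), Real.sqrt_sq (by norm_num)]
    refine Real.sqrt_le_sqrt ?_
    have : (n : ℝ) ≤ (4 * (2 * (k - e) + 1) : ℕ) := by exact_mod_cast h5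
    push_cast at this ⊢
    linarith
  have h6 := mul_le_mul h3' h5' (Real.sqrt_nonneg _) (by positivity)
  rw [Real.mul_self_sqrt hn0.le] at h6
  rw [div_mul_div_comm, one_mul, div_le_div_iff₀ (by positivity) hn0]
  linarith

/-- Most polynomials of degree close to `n` are typical. -/
lemma card_not_isTypical_le {n k L K L' T y N : ℕ} {E : ℝ} (hkn : k ≤ n) (hk : n ≤ k + L)
    (hL : 4 * L < n) (hy : 3 ≤ y) (hn : y ^ 2 * (2 * L' + 1) ≤ n) (hE : 2 ≤ E)
    (D₁ D₂ : Finset ℕ) (hD₁ : ∀ d ∈ D₁, d.Prime ∧ y ≤ d ∧ 2 * d ≤ k)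
    (hE₁ : E ≤ ∑ d ∈ D₁, (2 * d : ℝ)⁻¹) (hD₂ : ∀ d ∈ D₂, 3 ≤ d ∧ N ≤ d ∧ 2 * d ≤ k)
    (hE₂ : E ≤ ∑ d ∈ D₂, (2 * d : ℝ)⁻¹) :
    (({f ∈ monics F k | ¬ IsTypical n K L' y (y ^ 2) N f}).card : ℝ) ≤
      (4 / (K + 1) + (2 / 3) ^ T * √(2 * n + 1) + 2 ^ (T + K + 1) * (y : ℝ) ^ 3 * (L' + 1) / n +
        2 * (∑ d ∈ Finset.Icc 1 n, (d : ℝ)⁻¹) ^ 2 / y + 8 / E) * (Fintype.card F : ℝ) ^ k := by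
  have hE0 : 0 < E := by linarith
  have hn0 : 0 < n := by omega
  have hn' : (0 : ℝ) < n := by exact_mod_cast hn0
  set Q : ℝ := (Fintype.card F : ℝ) ^ k
  have hQ : 0 < Q := by
    have : (0 : ℝ) < Fintype.card F := by exact_mod_cast Fintype.card_pos
    positivity
  have b1 : (({f ∈ monics F k | K < sqful f}).card : ℝ) ≤ 4 / (K + 1) * Q := by
    rw [div_mul_eq_mul_div, le_div_iff₀ (by positivity)]
    exact card_lt_sqful_le k K
  have b2 : (({f ∈ monics F k | T < (normalizedFactors f).toFinset.card}).card : ℝ) ≤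
      (2 / 3) ^ T * √(2 * n + 1) * Q := by
    refine (card_lt_card_toFinset_le k T).trans ?_
    have : (k : ℝ) ≤ n := by exact_mod_cast hkn
    gcongr
  have b3 : (((Finset.Icc 2 (y ^ 2) ×ˢ Finset.range (L' + 1)).biUnion fun z : ℕ × ℕ =>
      {f ∈ monics F k | (normalizedFactors f).card ≤ T + K ∧
        ∃ h ∈ monics F (n / z.1 - z.2), h ∣ f}).card : ℝ) ≤
      2 ^ (T + K + 1) * (y : ℝ) ^ 3 * (L' + 1) / n * Q := by
    refine (Nat.cast_le.2 Finset.card_biUnion_le).trans ?_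
    rw [Nat.cast_sum]
    have hb : ∀ z ∈ Finset.Icc 2 (y ^ 2) ×ˢ Finset.range (L' + 1),
        (({f ∈ monics F k | (normalizedFactors f).card ≤ T + K ∧
          ∃ h ∈ monics F (n / z.1 - z.2), h ∣ f}).card : ℝ) ≤
        2 ^ (T + K) * (2 * y / n) * Q := by
      intro z hz
      rw [Finset.mem_product, Finset.mem_Icc, Finset.mem_range] at hz
      obtain ⟨h1, h2⟩ := one_div_sqrt_mul_le (n := n) (k := k) (L := L) (L' := L') (y := y)
        hk hL (by omega) hn hz.1.1 hz.1.2 (Nat.lt_succ_iff.1 hz.2)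
      refine (card_exists_dvd_le (T + K) h1).trans ?_
      rw [mul_assoc ((2 : ℝ) ^ (T + K))]
      gcongr
    refine (Finset.sum_le_card_nsmul _ _ _ hb).trans ?_
    rw [nsmul_eq_mul, Finset.card_product, Nat.card_Icc, Finset.card_range]
    have hc : ((y ^ 2 + 1 - 2 : ℕ) : ℝ) ≤ (y : ℝ) ^ 2 := by exact_mod_cast (by omega)
    calc _ ≤ ((y : ℝ) ^ 2 * (L' + 1)) * (2 ^ (T + K) * (2 * y / n) * Q) := by
          push_cast at hc ⊢
          gcongr
      _ = _ := by
          rw [pow_succ (2 : ℝ) (T + K)]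
          ring
  have b4 : (({f ∈ monics F k | HasCommonDegreeDivisor y f}).card : ℝ) ≤
      2 * (∑ d ∈ Finset.Icc 1 n, (d : ℝ)⁻¹) ^ 2 / y * Q := by
    refine (card_common_divisor_le (by omega) k).trans ?_
    have h1 : ∑ d ∈ Finset.Icc 1 k, (d : ℝ)⁻¹ ≤ ∑ d ∈ Finset.Icc 1 n, (d : ℝ)⁻¹ :=
      Finset.sum_le_sum_of_subset_of_nonneg (Finset.Icc_subset_Icc_right hkn)
        fun _ _ _ => by positivity
    have h2 : 0 ≤ ∑ d ∈ Finset.Icc 1 k, (d : ℝ)⁻¹ := Finset.sum_nonneg fun _ _ => by positivity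
    gcongr
  have b5 := card_not_two_factors_le (F := F) D₁
    (fun d hd => ⟨hy.trans (hD₁ d hd).2.1, (hD₁ d hd).2.2⟩) hE hE₁
  have b6 := card_not_two_factors_le (F := F) D₂
    (fun d hd => ⟨(hD₂ d hd).1, (hD₂ d hd).2.2⟩) hE hE₂
  have hsub : {f ∈ monics F k | ¬ IsTypical n K L' y (y ^ 2) N f} ⊆
      {f ∈ monics F k | K < sqful f} ∪
      ({f ∈ monics F k | T < (normalizedFactors f).toFinset.card} ∪
      (((Finset.Icc 2 (y ^ 2) ×ˢ Finset.range (L' + 1)).biUnion fun z : ℕ × ℕ =>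
        {f ∈ monics F k | (normalizedFactors f).card ≤ T + K ∧
          ∃ h ∈ monics F (n / z.1 - z.2), h ∣ f}) ∪
      ({f ∈ monics F k | HasCommonDegreeDivisor y f} ∪
      ({f ∈ monics F k | ¬ ∃ P Q : F[X], P ≠ Q ∧ (Irreducible P ∧ P.Monic ∧ P ∣ f) ∧
        (Irreducible Q ∧ Q.Monic ∧ Q ∣ f) ∧ P.natDegree ∈ D₁ ∧ Q.natDegree ∈ D₁} ∪
      {f ∈ monics F k | ¬ ∃ P Q : F[X], P ≠ Q ∧ (Irreducible P ∧ P.Monic ∧ P ∣ f) ∧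
        (Irreducible Q ∧ Q.Monic ∧ Q ∣ f) ∧ P.natDegree ∈ D₂ ∧ Q.natDegree ∈ D₂})))) := by
    intro f hf
    rw [Finset.mem_filter] at hf
    obtain ⟨hfm, hf⟩ := hf
    by_contra hcon
    simp only [Finset.mem_union, Finset.mem_filter, hfm, true_and, not_or, not_lt,
      not_not] at hcon
    obtain ⟨h1, h2, h3, h4, h5, h6⟩ := hcon
    refine hf ⟨h1, ?_, h4, ?_, ?_⟩
    · intro r t h hr hrR ht hh hhf heq
      refine h3 (Finset.mem_biUnion.2 ⟨(r, t), ?_, ?_⟩)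
      · rw [Finset.mem_product, Finset.mem_Icc, Finset.mem_range]
        exact ⟨⟨hr, hrR⟩, Nat.lt_succ_iff.2 ht⟩
      · rw [Finset.mem_filter]
        refine ⟨hfm, ?_, h, ?_, hhf⟩
        · have := card_normalizedFactors_le f
          omega
        · rw [mem_monics]
          refine ⟨hh, ?_⟩
          have : n / r = h.natDegree + t := by
            rw [← heq]
            exact Nat.mul_div_cancel _ (by omega)
          simp only
          omega
    · obtain ⟨P, -, -, hP, -, hPD, -⟩ := h5
      obtain ⟨h7, h8, h9⟩ := hD₁ _ hPD
      exact ⟨P, hP.1, hP.2.1, hP.2.2, h7, h8, h9.trans hkn⟩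
    · obtain ⟨P, Q, hne, hP, hQ, hPD, hQD⟩ := h6
      exact ⟨P, Q, hne, hP, hQ, (hD₂ _ hPD).2.1, (hD₂ _ hQD).2.1⟩
  have hfin := Finset.card_le_card hsub
  have e : (8 : ℝ) / E * Q = 4 / E * Q + 4 / E * Q := by ring
  rw [add_mul, add_mul, add_mul, add_mul, e]
  refine (Nat.cast_le.2 hfin).trans ?_
  refine (Nat.cast_le.2 (Finset.card_union_le _ _)).trans ?_
  rw [Nat.cast_add, add_assoc, add_assoc, add_assoc]
  refine add_le_add b1 ?_
  refine (Nat.cast_le.2 (Finset.card_union_le _ _)).trans ?_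
  rw [Nat.cast_add]
  refine add_le_add b2 ?_
  refine (Nat.cast_le.2 (Finset.card_union_le _ _)).trans ?_
  rw [Nat.cast_add]
  refine add_le_add b3 ?_
  refine (Nat.cast_le.2 (Finset.card_union_le _ _)).trans ?_
  rw [Nat.cast_add]
  refine add_le_add b4 ?_
  refine (Nat.cast_le.2 (Finset.card_union_le _ _)).trans ?_
  rw [Nat.cast_add]
  exact add_le_add b5 b6

end IsTypical

section TypicalAsymptotics

open Filter Topology

lemma eventually_typical_parameters (L K L' : ℕ) {ε : ℝ} (hε : 0 < ε) :
    ∀ᶠ a : ℕ in atTop, 4 * L < a ∧ L' < a ∧ 1 ≤ Nat.log 4 a ∧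
      (64 * (a : ℝ) ^ 3) ^ 2 * (2 * L' + 1) ≤ 1024 ^ a ∧
      (2 / 3 : ℝ) ^ (9 * a) * (46 * 32 ^ a) ≤ ε ∧
      2 ^ (9 * a + K + 1) * (64 * (a : ℝ) ^ 3) ^ 3 * (L' + 1) / 1024 ^ a ≤ ε ∧
      2 * (8 * ((a : ℝ) + 1)) ^ 2 / (a : ℝ) ^ 3 ≤ ε := by
  have h1 : Tendsto (fun a : ℕ => 4096 * (2 * L' + 1 : ℝ) * ((a : ℝ) ^ 6 * (1 / 1024) ^ a))
      atTop (𝓝 0) := by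
    simpa using (tendsto_pow_const_mul_const_pow_of_abs_lt_one (r := 1 / 1024) 6
      (by rw [abs_of_pos] <;> norm_num)).const_mul (4096 * (2 * L' + 1 : ℝ))
  have h2 : Tendsto (fun a : ℕ => 46 * (16384 / 19683 : ℝ) ^ a) atTop (𝓝 0) := by
    simpa using (tendsto_pow_atTop_nhds_zero_of_lt_one (r := (16384 / 19683 : ℝ)) (by norm_num)
      (by norm_num)).const_mul 46
  have h3 : Tendsto (fun a : ℕ => 2 ^ (K + 1) * 64 ^ 3 * (L' + 1 : ℝ) *
      ((a : ℝ) ^ 9 * (1 / 2) ^ a)) atTop (𝓝 0) := by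
    simpa using (tendsto_pow_const_mul_const_pow_of_abs_lt_one (r := 1 / 2) 9
      (by rw [abs_of_pos] <;> norm_num)).const_mul (2 ^ (K + 1) * 64 ^ 3 * (L' + 1 : ℝ))
  have h4 : Tendsto (fun a : ℕ => 512 * ((a : ℝ))⁻¹) atTop (𝓝 0) := by
    simpa using (tendsto_inv_atTop_zero.comp tendsto_natCast_atTop_atTop).const_mul (512 : ℝ)
  filter_upwards [eventually_gt_atTop (4 * L), eventually_gt_atTop L', eventually_ge_atTop 4,
    h1.eventually (gt_mem_nhds zero_lt_one), h2.eventually (gt_mem_nhds hε),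
    h3.eventually (gt_mem_nhds hε), h4.eventually (gt_mem_nhds hε)] with a a1 a2 a3 a4 a5 a6 a7
  have ha : (0 : ℝ) < a := by exact_mod_cast (by omega : 0 < a)
  refine ⟨a1, a2, Nat.log_pos (by norm_num) a3, ?_, ?_, ?_, ?_⟩
  · rw [one_div, inv_pow, ← div_eq_mul_inv, ← mul_div_assoc, div_lt_one (by positivity)] at a4
    refine le_trans (le_of_eq ?_) a4.le
    ring
  · refine le_trans (le_of_eq ?_) a5.le
    rw [pow_mul, mul_left_comm, ← mul_pow]
    norm_num
  · refine le_trans (le_of_eq ?_) a6.le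
    rw [show (1024 : ℝ) = 2 ^ 9 * 2 by norm_num, mul_pow, add_assoc, pow_add, pow_mul, one_div,
      inv_pow]
    field_simp
    rw [← mul_pow]
    norm_num
  · refine le_trans ?_ a7.le
    rw [div_le_iff₀ (by positivity)]
    have : (1 : ℝ) ≤ a := by exact_mod_cast (by omega : 1 ≤ a)
    have e : 512 * (a : ℝ)⁻¹ * a ^ 3 = 512 * a ^ 2 := by field_simp
    rw [e]
    nlinarith

lemma tendsto_natLog_atTop {b : ℕ} (hb : 1 < b) : Tendsto (Nat.log b) atTop atTop :=
  tendsto_atTop.2 fun c => (eventually_ge_atTop (b ^ c)).mono fun _ hn =>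
    Nat.le_log_of_pow_le hb hn

lemma sum_two_mul_inv (D : Finset ℕ) :
    ∑ d ∈ D, (2 * d : ℝ)⁻¹ = (∑ d ∈ D, (d : ℝ)⁻¹) / 2 := by
  rw [Finset.sum_div]
  exact Finset.sum_congr rfl fun d _ => by rw [mul_inv]; ring

lemma sum_inv_le_of_lt_pow {n a : ℕ} (hn : 0 < n) (hna : n < 1024 ^ (a + 1)) :
    ∑ d ∈ Finset.Icc 1 n, (d : ℝ)⁻¹ ≤ 8 * ((a : ℝ) + 1) := by
  have h3 := harmonic_le_one_add_log n
  rw [harmonic_eq_sum_Icc] at h3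
  push_cast at h3
  refine h3.trans ?_
  have h4 : Real.log n ≤ Real.log (1024 ^ (a + 1)) :=
    Real.log_le_log (by exact_mod_cast hn) (by exact_mod_cast hna.le)
  rw [Real.log_pow, show (1024 : ℝ) = 2 ^ 10 by norm_num, Real.log_pow] at h4
  have h5 := Real.log_two_lt_d9
  push_cast at h4
  have h6 : (0 : ℝ) ≤ a := Nat.cast_nonneg a
  nlinarith

set_option maxHeartbeats 1000000 in
/-- For suitable parameters, almost all monic polynomials of degree close to `n` are typical. -/
theorem eventually_card_not_isTypical_le (F : Type*) [Field F] [Fintype F] (L K L' : ℕ) {ε : ℝ}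
    (hε : 0 < ε) : ∀ᶠ n : ℕ in atTop, ∃ y N, L' < y ∧ L' < N ∧ y * n ≤ N * y ^ 2 ∧
      ∀ k, k ≤ n → n ≤ k + L →
        (({f ∈ monics F k | ¬ IsTypical n K L' y (y ^ 2) N f}).card : ℝ) ≤
          (4 / (K + 1) + 4 * ε) * (Fintype.card F : ℝ) ^ k := by
  obtain ⟨I, hI⟩ := exists_le_sum_primes_inv
  set E : ℝ := max 2 (8 / ε)
  have hlog1024 : Tendsto (Nat.log 1024) atTop atTop := tendsto_natLog_atTop (by norm_num)
  have hlog4 : Tendsto (Nat.log 4) atTop atTop := tendsto_natLog_atTop (by norm_num)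
  have hlogE : ∀ᶠ s : ℕ in atTop, 16 * E + 1 ≤ Real.log (s + 1 : ℕ) :=
    (Real.tendsto_log_atTop.comp (tendsto_natCast_atTop_atTop.comp
      (tendsto_add_atTop_nat 1))).eventually_ge_atTop _
  filter_upwards [hlog1024.eventually (eventually_typical_parameters L K L' hε),
    (hlog4.comp hlog1024).eventually hlogE, (hlog4.comp hlog1024).eventually_ge_atTop I,
    eventually_gt_atTop 0] with n hpar hlog hsI hn0
  simp only [Function.comp] at hlog hsI
  set a := Nat.log 1024 n
  set s := Nat.log 4 a
  obtain ⟨p1, p2, p3, p4, p5, p6, p7⟩ := hpar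
  have ha0 : a ≠ 0 := by omega
  have hna : 1024 ^ a ≤ n := Nat.pow_log_le_self 1024 hn0.ne'
  have hna' : n < 1024 ^ (a + 1) := Nat.lt_pow_succ_log_self (by norm_num) n
  have has : 4 ^ s ≤ a := Nat.pow_log_le_self 4 ha0
  have has' : a < 4 ^ (s + 1) := Nat.lt_pow_succ_log_self (by norm_num) a
  have hss : (s + 1) ^ 2 ≤ 4 ^ s := by
    rw [show 4 = 2 ^ 2 by norm_num, ← pow_mul, mul_comm 2 s, pow_mul]
    exact Nat.pow_le_pow_left (Nat.lt_two_pow_self) 2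
  have hsa : (s + 1) * (s + 1) ≤ a := by
    rw [← sq]
    exact hss.trans has
  have hsa2 : 2 * (s + 1) ≤ (s + 1) * (s + 1) := Nat.mul_le_mul_right _ (by omega)
  have hE2 : 2 ≤ E := le_max_left _ _
  have hEε : 8 / E ≤ ε := by
    rw [div_le_iff₀ (by linarith)]
    have := le_max_right 2 (8 / ε)
    rw [div_le_iff₀ hε] at this
    linarith
  set y := 4 ^ (3 * (s + 1)) with hy
  have hya : a ^ 3 ≤ y := by
    rw [hy, mul_comm, pow_mul]
    exact Nat.pow_le_pow_left has'.le 3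
  have hya' : y ≤ 64 * a ^ 3 := by
    have e : y = 64 * (4 ^ s) ^ 3 := by
      rw [hy, mul_comm, pow_mul, pow_succ' 4 s, mul_pow]
      norm_num
    rw [e]
    exact Nat.mul_le_mul_left _ (Nat.pow_le_pow_left has 3)
  have haa : a ≤ a ^ 3 := Nat.le_self_pow (by norm_num) a
  have hy64 : 64 ≤ y := by
    rw [hy]
    calc 64 = 4 ^ 3 := by norm_num
      _ ≤ _ := Nat.pow_le_pow_right (by norm_num) (by omega)
  have hyn : y ^ 2 * (2 * L' + 1) ≤ n := by
    refine le_trans (Nat.mul_le_mul_right _ (Nat.pow_le_pow_left hya' 2)) (le_trans ?_ hna)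
    exact_mod_cast p4
  have hyn2 : 2 * y ≤ n := by nlinarith
  have han : a < 1024 ^ a := Nat.lt_pow_self (by norm_num)
  have hn' : (0 : ℝ) < n := by exact_mod_cast hn0
  have hy' : (0 : ℝ) < y := by exact_mod_cast (by omega : 0 < y)
  refine ⟨y, n / y + 1, by omega, ?_, ?_, fun k hkn hk => ?_⟩
  · refine Nat.lt_succ_of_le ((Nat.le_div_iff_mul_le (by omega)).2 ?_)
    nlinarith
  · have := Nat.lt_mul_div_succ n (show 0 < y by omega)
    nlinarith
  set D₁ := (Finset.Ioc (4 ^ (3 * (s + 1)) : ℕ) (4 ^ (5 * a - 1))).filter Nat.Prime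
  set D₂ := Finset.Ioc (n / y) (k / 2)
  have hD₁ : ∀ d ∈ D₁, d.Prime ∧ y ≤ d ∧ 2 * d ≤ k := by
    intro d hd
    simp only [D₁, Finset.mem_filter, Finset.mem_Ioc] at hd
    refine ⟨hd.2, hd.1.1.le, ?_⟩
    have h4 : 4 * 4 ^ (5 * a - 1) = 1024 ^ a := by
      rw [← pow_succ', show 5 * a - 1 + 1 = 5 * a by omega, pow_mul]
      norm_num
    omega
  have hD₂ : ∀ d ∈ D₂, 3 ≤ d ∧ n / y + 1 ≤ d ∧ 2 * d ≤ k := by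
    intro d hd
    simp only [D₂, Finset.mem_Ioc] at hd
    have : 2 ≤ n / y := (Nat.le_div_iff_mul_le (by omega)).2 hyn2
    omega
  have hE₁ : E ≤ ∑ d ∈ D₁, (2 * d : ℝ)⁻¹ := by
    rw [sum_two_mul_inv]
    have h1 := hI (3 * (s + 1)) (5 * a - 1) (by omega) (by omega) (by omega)
    have h2 : Real.log (s + 1 : ℕ) ≤
        Real.log (((5 * a - 1 : ℕ) + 1) / (3 * (s + 1) : ℕ)) := by
      refine Real.log_le_log (by positivity) ?_
      rw [le_div_iff₀ (by positivity)]
      have : (s + 1) * (3 * (s + 1)) ≤ 5 * a - 1 + 1 := by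
        rw [mul_left_comm]
        omega
      exact_mod_cast this
    have h3 : (Real.log (((5 * a - 1 : ℕ) + 1) / (3 * (s + 1) : ℕ)) - 1) / 8 ≤
      ∑ d ∈ D₁, (d : ℝ)⁻¹ := h1
    linarith
  have hE₂ : E ≤ ∑ d ∈ D₂, (2 * d : ℝ)⁻¹ := by
    rw [sum_two_mul_inv]
    have hA : 2 ≤ n / y := (Nat.le_div_iff_mul_le (by omega)).2 hyn2
    have hA4 : n / y ≤ n / 4 := Nat.div_le_div_left (by omega) (by norm_num)
    have h1 := harmonic_sub_ge (A := n / y) (B := k / 2) (by omega) (by omega)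
    have h2 : Real.log (s + 1 : ℕ) ≤ Real.log (((k / 2 : ℕ) + 1) / (n / y : ℕ)) := by
      refine Real.log_le_log (by positivity) ?_
      have hA0 : (0 : ℝ) < (n / y : ℕ) := by exact_mod_cast (by omega : 0 < n / y)
      rw [le_div_iff₀ hA0]
      have h3 : (s + 1) * 4 ≤ y := by
        have : s + 1 ≤ 4 ^ s := le_trans (Nat.le_self_pow (by norm_num) _) hss
        calc (s + 1) * 4 ≤ 4 ^ s * 4 := Nat.mul_le_mul_right 4 this
          _ = 4 ^ (s + 1) := (pow_succ 4 s).symm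
          _ ≤ y := Nat.pow_le_pow_right (by norm_num) (by omega)
      have h4 : (s + 1) * (n / y) * 4 ≤ n := by
        calc _ = (s + 1) * 4 * (n / y) := by ring
          _ ≤ y * (n / y) := Nat.mul_le_mul_right _ h3
          _ ≤ n := Nat.mul_div_le n y
      have h5 : (s + 1) * (n / y) ≤ k / 2 + 1 := by omega
      exact_mod_cast h5
    linarith
  refine (card_not_isTypical_le (F := F) (T := 9 * a) (K := K) hkn hk (by omega) (by omega) hyn
    hE2 D₁ D₂ hD₁ hE₁ hD₂ hE₂).trans ?_
  refine mul_le_mul_of_nonneg_right ?_ (by positivity)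
  have q1 : (2 / 3 : ℝ) ^ (9 * a) * √(2 * n + 1) ≤ ε := by
    refine le_trans (mul_le_mul_of_nonneg_left ?_ (by positivity)) p5
    refine Real.sqrt_le_iff.2 ⟨by positivity, ?_⟩
    rw [mul_pow, ← pow_mul, mul_comm a 2, pow_mul]
    have h1 : 2 * n + 1 ≤ 2116 * 1024 ^ a := by
      rw [pow_succ] at hna'; omega
    have h2 : ((2 * n + 1 : ℕ) : ℝ) ≤ (2116 * 1024 ^ a : ℕ) := Nat.cast_le.2 h1
    push_cast at h2
    refine h2.trans (le_of_eq ?_)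
    norm_num
  have q2 : 2 ^ (9 * a + K + 1) * (y : ℝ) ^ 3 * (L' + 1) / n ≤ ε := by
    refine le_trans ?_ p6
    have h1 : (y : ℝ) ≤ 64 * (a : ℝ) ^ 3 := by exact_mod_cast hya'
    have h2 : (1024 : ℝ) ^ a ≤ n := by exact_mod_cast hna
    gcongr
  have q3 : 2 * (∑ d ∈ Finset.Icc 1 n, (d : ℝ)⁻¹) ^ 2 / y ≤ ε := by
    refine le_trans ?_ p7
    have h1 : (a : ℝ) ^ 3 ≤ y := by exact_mod_cast hya
    have h2 := sum_inv_le_of_lt_pow hn0 hna'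
    have h7 : 0 ≤ ∑ d ∈ Finset.Icc 1 n, (d : ℝ)⁻¹ := Finset.sum_nonneg fun _ _ => by positivity
    have h8 : (0 : ℝ) < a := by exact_mod_cast (by omega : 0 < a)
    gcongr
  linarith

end TypicalAsymptotics

section Krylov

open Polynomial

variable {F V : Type*} [Field F] [AddCommGroup V] [Module F V]

/-- `f` is the monic generator of the annihilator of `e` in the `F[X]`-module defined by `T`. -/
def IsVectorMinpoly (T : Module.End F V) (e : V) (f : F[X]) : Prop :=
  f.Monic ∧ aeval T f e = 0 ∧ ∀ g : F[X], g ≠ 0 → g.natDegree < f.natDegree → aeval T g e ≠ 0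

lemma exists_isVectorMinpoly [FiniteDimensional F V] (T : Module.End F V) (e : V) :
    ∃ f, IsVectorMinpoly T e f ∧ f ∣ T.charpoly := by
  have hex : ∃ k, ∃ f : F[X], f.Monic ∧ aeval T f e = 0 ∧ f.natDegree = k :=
    ⟨_, T.charpoly, T.charpoly_monic, by rw [T.aeval_self_charpoly]; rfl, rfl⟩
  obtain ⟨f, hf, hfe, hk⟩ := Nat.find_spec hex
  have hmin : ∀ g : F[X], g ≠ 0 → g.natDegree < f.natDegree → aeval T g e ≠ 0 := by
    intro g hg hlt h0
    refine Nat.find_min hex (hk ▸ hlt) ⟨g * C g.leadingCoeff⁻¹, monic_mul_leadingCoeff_inv hg, ?_,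
      natDegree_mul_leadingCoeff_inv g hg⟩
    rw [mul_comm, map_mul, Module.End.mul_apply, h0, map_zero]
  refine ⟨f, ⟨hf, hfe, hmin⟩, ?_⟩
  rw [← modByMonic_eq_zero_iff_dvd hf]
  by_contra hne
  by_cases h1 : f = 1
  · subst h1
    simp at hne
  refine hmin _ hne (natDegree_modByMonic_lt _ hf h1) ?_
  rw [modByMonic_eq_sub_mul_div, mul_comm f, map_sub, T.aeval_self_charpoly, map_mul]
  simp [hfe]

lemma exists_dual_of_isVectorMinpoly {T : Module.End F V} {e : V} {f : F[X]} {k : ℕ}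
    (hf : IsVectorMinpoly T e f) (hk : f.natDegree = k + 1) :
    ∃ l : Module.Dual F V, l ((T ^ k) e) = 1 ∧ ∀ i < k, l ((T ^ i) e) = 0 := by
  let φ : F[X] →ₗ[F] V := (LinearMap.applyₗ e).comp (aeval T).toLinearMap
  have hφ : ∀ g, φ g = aeval T g e := fun g => rfl
  have hnot : (T ^ k) e ∉ (degreeLT F k).map φ := by
    rintro ⟨g, hg, hge⟩
    have hg' := mem_degreeLT.1 hg
    have hmon := monic_X_pow_sub (n := k) (p := g) hg'
    refine hf.2.2 (X ^ k - g) hmon.ne_zero ?_ ?_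
    · have h1 : (X ^ k - g).degree = ((k : ℕ) : WithBot ℕ) := by
        rw [degree_sub_eq_left_of_degree_lt (by rwa [degree_X_pow]), degree_X_pow]
      rw [natDegree_eq_of_degree_eq_some h1, hk]
      exact Nat.lt_succ_self k
    · rw [map_sub, LinearMap.sub_apply, ← hφ g, hge, map_pow, aeval_X, sub_self]
  obtain ⟨l, hl, hker⟩ := Submodule.exists_le_ker_of_notMem hnot
  refine ⟨(l ((T ^ k) e))⁻¹ • l, ?_, fun i hi => ?_⟩
  · simp [hl]
  · have : (T ^ i) e ∈ (degreeLT F k).map φ := by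
      refine ⟨X ^ i, mem_degreeLT.2 ?_, by simp [hφ]⟩
      rw [degree_X_pow]
      exact_mod_cast hi
    simp [LinearMap.mem_ker.1 (hker this)]

lemma pow_add_smulRight_apply (T : Module.End F V) (e w : V) {k : ℕ} {l : Module.Dual F V}
    (hl : ∀ i < k, l ((T ^ i) e) = 0) {i : ℕ} (hi : i ≤ k) :
    ((T + l.smulRight w) ^ i) e = (T ^ i) e := by
  induction i with
  | zero => simp
  | succ i ih =>
    rw [pow_succ', Module.End.mul_apply, ih (by omega), pow_succ', Module.End.mul_apply]
    simp [hl i (by omega)]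

lemma aeval_add_smulRight_apply (T : Module.End F V) (e w : V) {k : ℕ} {l : Module.Dual F V}
    (hl : ∀ i < k, l ((T ^ i) e) = 0) (hl1 : l ((T ^ k) e) = 1) {f : F[X]} (hf : f.Monic)
    (hk : f.natDegree = k + 1) :
    aeval (T + l.smulRight w) f e = aeval T f e + w := by
  have hlead : f.coeff (k + 1) = 1 := hk ▸ hf
  rw [aeval_eq_sum_range, aeval_eq_sum_range, hk, Finset.sum_range_succ, Finset.sum_range_succ _ (k + 1),
    hlead, LinearMap.add_apply, LinearMap.add_apply, LinearMap.sum_apply, LinearMap.sum_apply,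
    one_smul, one_smul, add_assoc]
  congr 1
  · refine Finset.sum_congr rfl fun i hi => ?_
    rw [LinearMap.smul_apply, LinearMap.smul_apply, pow_add_smulRight_apply T e w hl]
    exact Nat.lt_succ_iff.1 (Finset.mem_range.1 hi)
  · rw [pow_succ', Module.End.mul_apply, pow_add_smulRight_apply T e w hl le_rfl, pow_succ',
      Module.End.mul_apply]
    simp [hl1]

lemma card_isVectorMinpoly_le [Finite F] [Finite V] (e : V) {f : F[X]} (hk : f.natDegree ≠ 0) :
    Nat.card {T : Module.End F V // IsVectorMinpoly T e f} * Nat.card V ≤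
      Nat.card (Module.End F V) := by
  obtain ⟨k, hk⟩ := Nat.exists_eq_succ_of_ne_zero hk
  let v : Module.End F V → ℕ → V := fun T i => if i ≤ k then (T ^ i) e else 0
  let Λ : (ℕ → V) → Module.Dual F V := fun u =>
    if h : ∃ l : Module.Dual F V, l (u k) = 1 ∧ ∀ i < k, l (u i) = 0 then h.choose else 0
  have hΛ : ∀ T, IsVectorMinpoly T e f →
      Λ (v T) ((T ^ k) e) = 1 ∧ ∀ i < k, Λ (v T) ((T ^ i) e) = 0 := by
    intro T hT
    have h : ∃ l : Module.Dual F V, l (v T k) = 1 ∧ ∀ i < k, l (v T i) = 0 := by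
      obtain ⟨l, hl1, hl⟩ := exists_dual_of_isVectorMinpoly hT hk
      refine ⟨l, by simpa [v] using hl1, fun i hi => by simpa [v, hi.le] using hl i hi⟩
    have hs := h.choose_spec
    simp only [Λ, dif_pos h]
    refine ⟨by simpa [v] using hs.1, fun i hi => by simpa [v, hi.le] using hs.2 i hi⟩
  have hv : ∀ T w, IsVectorMinpoly T e f → v (T + (Λ (v T)).smulRight w) = v T := by
    intro T w hT
    funext i
    by_cases hi : i ≤ k
    · simp only [v, if_pos hi]
      exact pow_add_smulRight_apply T e w (hΛ T hT).2 hi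
    · simp only [v, if_neg hi]
  have : Finite (Module.End F V) := Finite.of_injective _ DFunLike.coe_injective
  rw [← Nat.card_prod]
  refine Nat.card_le_card_of_injective
    (fun x : {T : Module.End F V // IsVectorMinpoly T e f} × V =>
      x.1.1 + (Λ (v x.1.1)).smulRight x.2) ?_
  rintro ⟨⟨T, hT⟩, w⟩ ⟨⟨T', hT'⟩, w'⟩ h
  simp only at h
  have h1 : v T = v T' := by rw [← hv T w hT, h, hv T' w' hT']
  have h2 : w = w' := by
    have := aeval_add_smulRight_apply T e w (hΛ T hT).2 (hΛ T hT).1 hT.1 hk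
    rw [h, aeval_add_smulRight_apply T' e w' (hΛ T' hT').2 (hΛ T' hT').1 hT'.1 hk, hT.2.1,
      hT'.2.1, zero_add, zero_add] at this
    exact this.symm
  subst h2
  rw [h1] at h
  simpa using h

end Krylov

section MatrixCount

open Polynomial

variable {F : Type*} [Field F] [Fintype F]

lemma card_matrix_isVectorMinpoly_le {n : ℕ} (e : Fin n → F) {f : F[X]} (hk : f.natDegree ≠ 0) :
    (Finset.univ.filter fun M : Matrix (Fin n) (Fin n) F =>
      IsVectorMinpoly (Matrix.toLin' M) e f).card * Fintype.card F ^ n ≤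
      Fintype.card F ^ (n * n) := by
  have h := card_isVectorMinpoly_le e hk
  have e1 : Nat.card {T : Module.End F (Fin n → F) // IsVectorMinpoly T e f} =
      (Finset.univ.filter fun M : Matrix (Fin n) (Fin n) F =>
        IsVectorMinpoly (Matrix.toLin' M) e f).card := by
    rw [← Fintype.card_subtype, ← Nat.card_eq_fintype_card]
    exact (Nat.card_congr (Equiv.subtypeEquiv Matrix.toLin'.toEquiv fun _ => Iff.rfl)).symm
  have e2 : Nat.card (Module.End F (Fin n → F)) = Fintype.card F ^ (n * n) := by
    rw [← Nat.card_congr (Matrix.toLin' (R := F) (m := Fin n) (n := Fin n)).toEquiv,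
      ← Nat.card_congr (Matrix.of (m := Fin n) (n := Fin n) (α := F))]
    simp [Nat.card_eq_fintype_card, pow_mul]
  rw [e1, e2] at h
  simpa using h

lemma card_matrix_charpoly_le {n L : ℕ} (hn : n ≠ 0) {δ : ℝ} (hδ : 0 ≤ δ) (Q : F[X] → Prop)
    (hQ : ∀ k, k ≤ n → n ≤ k + L →
      (((monics F k).filter fun f => ¬ Q f).card : ℝ) ≤ δ * (Fintype.card F : ℝ) ^ k) :
    ((Finset.univ.filter fun M : Matrix (Fin n) (Fin n) F =>
      ¬ ∃ f : F[X], f.Monic ∧ f ∣ M.charpoly ∧ n ≤ f.natDegree + L ∧ Q f).card : ℝ) ≤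
      (2 * δ + 1 / (Fintype.card F : ℝ) ^ L) * (Fintype.card F : ℝ) ^ (n * n) := by
  have : NeZero n := ⟨hn⟩
  set q := Fintype.card F
  let e : Fin n → F := Pi.single 0 1
  let B : ℕ → Finset F[X] := fun k =>
    (monics F k).filter fun f => n ≤ k + L → ¬ Q f
  let S : F[X] → Finset (Matrix (Fin n) (Fin n) F) := fun f =>
    Finset.univ.filter fun M => IsVectorMinpoly (Matrix.toLin' M) e f
  have hsub : (Finset.univ.filter fun M : Matrix (Fin n) (Fin n) F =>
      ¬ ∃ f : F[X], f.Monic ∧ f ∣ M.charpoly ∧ n ≤ f.natDegree + L ∧ Q f) ⊆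
      (Finset.Icc 1 n).biUnion fun k => (B k).biUnion S := by
    intro M hM
    rw [Finset.mem_filter] at hM
    obtain ⟨f, hf, hdvd⟩ := exists_isVectorMinpoly (Matrix.toLin' M) e
    rw [Matrix.charpoly_toLin'] at hdvd
    have hdeg : f.natDegree ≤ n := by
      simpa using natDegree_le_of_dvd hdvd M.charpoly_monic.ne_zero
    have hdeg0 : f.natDegree ≠ 0 := by
      intro h0
      have h1 : f = 1 := hf.1.natDegree_eq_zero.1 h0
      have := hf.2.1
      rw [h1, map_one] at this
      have := congrFun this 0
      simp [e] at this
    simp only [Finset.mem_biUnion, Finset.mem_Icc]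
    refine ⟨f.natDegree, ⟨by omega, hdeg⟩, f, ?_, ?_⟩
    · simp only [B, Finset.mem_filter, mem_monics]
      exact ⟨⟨hf.1, trivial⟩, fun h hQf => hM.2 ⟨f, hf.1, hdvd, h, hQf⟩⟩
    · simp only [S, Finset.mem_filter]
      exact ⟨Finset.mem_univ _, hf⟩
  have hcount : (Finset.univ.filter fun M : Matrix (Fin n) (Fin n) F =>
      ¬ ∃ f : F[X], f.Monic ∧ f ∣ M.charpoly ∧ n ≤ f.natDegree + L ∧ Q f).card * q ^ n ≤
      (∑ k ∈ Finset.Icc 1 n, (B k).card) * q ^ (n * n) := by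
    refine (Nat.mul_le_mul_right _ ((Finset.card_le_card hsub).trans Finset.card_biUnion_le)).trans
      ?_
    rw [Finset.sum_mul, Finset.sum_mul]
    refine Finset.sum_le_sum fun k hk => ?_
    refine (Nat.mul_le_mul_right _ Finset.card_biUnion_le).trans ?_
    rw [Finset.sum_mul, ← smul_eq_mul]
    refine Finset.sum_le_card_nsmul _ _ _ fun f hf => ?_
    simp only [B, Finset.mem_filter, mem_monics] at hf
    refine card_matrix_isVectorMinpoly_le e ?_
    rw [hf.1.2]
    have := (Finset.mem_Icc.1 hk).1
    omega
  have hB : ∀ k ∈ Finset.Icc 1 n, ((B k).card : ℝ) ≤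
      δ * (q : ℝ) ^ k + if k < n - L then (q : ℝ) ^ k else 0 := by
    intro k hk
    rw [Finset.mem_Icc] at hk
    by_cases h : n ≤ k + L
    · rw [if_neg (by omega), add_zero]
      refine le_trans (Nat.cast_le.2 (Finset.card_le_card ?_)) (hQ k hk.2 h)
      exact Finset.monotone_filter_right _ fun f _ hf => hf h
    · rw [if_pos (by omega)]
      have h1 : (B k).card ≤ q ^ k := (Finset.card_filter_le _ _).trans_eq (card_monics k)
      have h2 : ((B k).card : ℝ) ≤ (q : ℝ) ^ k := by exact_mod_cast h1
      have : 0 ≤ δ * (q : ℝ) ^ k := by positivity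
      linarith
  have hq1 : (2 : ℝ) ≤ q := two_le_card_field
  have hgeom : ∀ N : ℕ, ∑ k ∈ Finset.range N, (q : ℝ) ^ k ≤ (q : ℝ) ^ N := by
    intro N
    induction N with
    | zero => simp
    | succ N ih =>
      rw [Finset.sum_range_succ, pow_succ]
      have : (0 : ℝ) ≤ (q : ℝ) ^ N := by positivity
      nlinarith
  have hsum1 : ∑ k ∈ Finset.Icc 1 n, (q : ℝ) ^ k ≤ 2 * (q : ℝ) ^ n := by
    have h1 : ∑ k ∈ Finset.Icc 1 n, (q : ℝ) ^ k ≤ ∑ k ∈ Finset.range (n + 1), (q : ℝ) ^ k := by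
      refine Finset.sum_le_sum_of_subset_of_nonneg ?_ fun _ _ _ => by positivity
      intro k hk
      rw [Finset.mem_Icc] at hk
      exact Finset.mem_range.2 (by omega)
    rw [Finset.sum_range_succ] at h1
    have := hgeom n
    linarith
  have hsum2 : ∑ k ∈ Finset.Icc 1 n, (if k < n - L then (q : ℝ) ^ k else 0) ≤
      1 / (q : ℝ) ^ L * (q : ℝ) ^ n := by
    by_cases hL : L ≤ n
    · rw [← Finset.sum_filter]
      have h1 : ∑ k ∈ (Finset.Icc 1 n).filter (· < n - L), (q : ℝ) ^ k ≤
          ∑ k ∈ Finset.range (n - L), (q : ℝ) ^ k := by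
        refine Finset.sum_le_sum_of_subset_of_nonneg ?_ fun _ _ _ => by positivity
        intro k hk
        exact Finset.mem_range.2 (Finset.mem_filter.1 hk).2
      refine (h1.trans (hgeom _)).trans (le_of_eq ?_)
      have h2 : (q : ℝ) ^ n = (q : ℝ) ^ (n - L) * (q : ℝ) ^ L := by
        rw [← pow_add]; congr 1; omega
      rw [h2]
      field_simp
    · rw [Finset.sum_eq_zero fun k _ => if_neg (by omega)]
      positivity
  have hBsum : ((∑ k ∈ Finset.Icc 1 n, (B k).card : ℕ) : ℝ) ≤
      (2 * δ + 1 / (q : ℝ) ^ L) * (q : ℝ) ^ n := by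
    push_cast
    refine (Finset.sum_le_sum hB).trans ?_
    rw [Finset.sum_add_distrib, ← Finset.mul_sum]
    have := mul_le_mul_of_nonneg_left hsum1 hδ
    linarith
  have hpos : (0 : ℝ) < (q : ℝ) ^ n := by positivity
  refine le_of_mul_le_mul_right ?_ hpos
  have hc : ((Finset.univ.filter fun M : Matrix (Fin n) (Fin n) F =>
      ¬ ∃ f : F[X], f.Monic ∧ f ∣ M.charpoly ∧ n ≤ f.natDegree + L ∧ Q f).card : ℝ) * (q : ℝ) ^ n ≤
      ((∑ k ∈ Finset.Icc 1 n, (B k).card : ℕ) : ℝ) * (q : ℝ) ^ (n * n) := by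
    exact_mod_cast hcount
  refine hc.trans ((mul_le_mul_of_nonneg_right hBsum (by positivity)).trans (le_of_eq ?_))
  ring

end MatrixCount

section FrobeniusCycles

open Polynomial UniqueFactorizationMonoid Function Equiv

variable {F : Type*} [Field F] [Fintype F]

lemma prod_dvd_of_monic_irreducible {T : Finset F[X]} {g : F[X]}
    (hT : ∀ P ∈ T, Irreducible P ∧ P.Monic ∧ P ∣ g) : ∏ P ∈ T, P ∣ g := by
  refine Finset.prod_dvd_of_coprime (fun P hP Q hQ hne => ?_) fun P hP => (hT P hP).2.2
  refine (hT P hP).1.coprime_iff_not_dvd.2 fun h => hne ?_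
  exact eq_of_monic_of_associated (hT P hP).2.1 (hT Q hQ).2.1
    ((hT P hP).1.associated_of_dvd (hT Q hQ).1 h)

/-- The monic irreducible polynomials dividing `f` exactly once and not dividing `g`. -/
def simpleFactors (f g : F[X]) : Finset F[X] :=
  (normalizedFactors f).toFinset.filter fun P => (normalizedFactors f).count P = 1 ∧ ¬ P ∣ g

lemma mem_simpleFactors {f g P : F[X]} (hf : f ≠ 0) : P ∈ simpleFactors f g ↔
    Irreducible P ∧ P.Monic ∧ P ∣ f ∧ (normalizedFactors f).count P = 1 ∧ ¬ P ∣ g := by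
  rw [simpleFactors, Finset.mem_filter, Multiset.mem_toFinset, mem_normalizedFactors_iff_of_monic hf,
    and_assoc, and_assoc]

lemma natDegree_le_sum_simpleFactors {f g : F[X]} (hf : f.Monic) (hg : g ≠ 0) :
    f.natDegree ≤ ∑ P ∈ simpleFactors f g, P.natDegree + sqful f + g.natDegree := by
  have h1 : f.natDegree = ∑ P ∈ (normalizedFactors f).toFinset,
      (normalizedFactors f).count P * P.natDegree := by
    rw [natDegree_eq_sum_normalizedFactors hf, Finset.sum_multiset_map_count]
    rfl
  have h2 : ∑ P ∈ (normalizedFactors f).toFinset.filter (· ∣ g), P.natDegree ≤ g.natDegree := by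
    rw [← natDegree_prod_of_monic]
    · refine natDegree_le_of_dvd (prod_dvd_of_monic_irreducible fun P hP => ?_) hg
      rw [Finset.mem_filter, Multiset.mem_toFinset,
        mem_normalizedFactors_iff_of_monic hf.ne_zero] at hP
      exact ⟨hP.1.1, hP.1.2.1, hP.2⟩
    · intro P hP
      rw [Finset.mem_filter, Multiset.mem_toFinset] at hP
      exact monic_of_mem_normalizedFactors hP.1
  refine le_trans ?_ (Nat.add_le_add_left h2 _)
  rw [h1, simpleFactors, sqful, Finset.sum_filter, Finset.sum_filter, ← Finset.sum_add_distrib,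
    ← Finset.sum_add_distrib]
  refine Finset.sum_le_sum fun P hP => ?_
  have h0 : 1 ≤ (normalizedFactors f).count P :=
    Multiset.one_le_count_iff_mem.2 (Multiset.mem_toFinset.1 hP)
  by_cases hc : 2 ≤ (normalizedFactors f).count P
  · rw [if_pos hc]
    omega
  · have hc1 : (normalizedFactors f).count P = 1 := by omega
    by_cases hd : P ∣ g
    · simp [hc1, hd]
    · simp [hc1, hd]

lemma mem_simpleFactors_of_lt {f g P : F[X]} (hf : f ≠ 0) (hg : g ≠ 0) (hP : Irreducible P)
    (hPm : P.Monic) (hPf : P ∣ f) (h1 : sqful f < P.natDegree) (h2 : g.natDegree < P.natDegree) :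
    P ∈ simpleFactors f g := by
  have hmem := (mem_normalizedFactors_iff_of_monic hf).2 ⟨hP, hPm, hPf⟩
  refine (mem_simpleFactors hf).2 ⟨hP, hPm, hPf, ?_, fun h => ?_⟩
  · have h0 : 1 ≤ (normalizedFactors f).count P := Multiset.one_le_count_iff_mem.2 hmem
    by_contra hne
    have h2 : 2 ≤ (normalizedFactors f).count P := by omega
    have h3 := Finset.single_le_sum (f := fun P : F[X] => if 2 ≤ (normalizedFactors f).count P then
      (normalizedFactors f).count P * P.natDegree else 0) (fun _ _ => Nat.zero_le _)
      (Multiset.mem_toFinset.2 hmem)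
    simp only [if_pos h2] at h3
    have h4 : P.natDegree ≤ (normalizedFactors f).count P * P.natDegree :=
      Nat.le_mul_of_pos_left _ h0
    exact absurd (h4.trans h3) (not_le.2 h1)
  · exact absurd (natDegree_le_of_dvd h hg) (not_le.2 h2)

variable {κ α : Type*} [Field κ] [Algebra F κ] [Fintype α] {σ : Perm α} {ρ : α → κ} {Φ : F[X]}

lemma monic_of_map_eq_prod (hΦ : Φ.map (algebraMap F κ) = ∏ x, (X - C (ρ x))) : Φ.Monic := by
  refine monic_of_injective (algebraMap F κ).injective ?_
  rw [hΦ]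
  exact monic_prod_of_monic _ _ fun _ _ => monic_X_sub_C _

lemma natDegree_of_map_eq_prod (hΦ : Φ.map (algebraMap F κ) = ∏ x, (X - C (ρ x))) :
    Φ.natDegree = Fintype.card α := by
  rw [← natDegree_map (algebraMap F κ), hΦ, natDegree_prod_of_monic _ _ fun _ _ => monic_X_sub_C _]
  simp

lemma roots_map_of_map_eq_prod (hΦ : Φ.map (algebraMap F κ) = ∏ x, (X - C (ρ x))) :
    (Φ.map (algebraMap F κ)).roots = Finset.univ.val.map ρ := by
  rw [hΦ, ← roots_multiset_prod_X_sub_C (Finset.univ.val.map ρ), Multiset.map_map]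
  rfl

lemma splits_of_map_eq_prod (hΦ : Φ.map (algebraMap F κ) = ∏ x, (X - C (ρ x))) :
    (Φ.map (algebraMap F κ)).Splits := by
  rw [hΦ]
  exact Splits.prod fun _ _ => Splits.X_sub_C _

lemma aeval_of_map_eq_prod (hΦ : Φ.map (algebraMap F κ) = ∏ x, (X - C (ρ x))) (x : α) :
    aeval (ρ x) Φ = 0 := by
  rw [aeval_def, ← eval_map, hΦ, eval_prod]
  exact Finset.prod_eq_zero (Finset.mem_univ x) (by simp)

lemma isIntegral_of_map_eq_prod (hΦ : Φ.map (algebraMap F κ) = ∏ x, (X - C (ρ x))) (x : α) :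
    IsIntegral F (ρ x) :=
  ⟨Φ, monic_of_map_eq_prod hΦ, aeval_of_map_eq_prod hΦ x⟩

lemma ncard_minpoly_eq (hΦ : Φ.map (algebraMap F κ) = ∏ x, (X - C (ρ x))) {P B : F[X]}
    (hPB : Φ = P * B) (hP : Irreducible P) (hPm : P.Monic) (hB : ¬ P ∣ B) :
    {x | minpoly F (ρ x) = P}.ncard = P.natDegree := by
  have hΦ0 : Φ.map (algebraMap F κ) ≠ 0 :=
    ((monic_of_map_eq_prod hΦ).map _).ne_zero
  have hsplit : (P.map (algebraMap F κ)).Splits :=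
    (splits_of_map_eq_prod hΦ).of_dvd hΦ0 (Polynomial.map_dvd _ ⟨B, hPB⟩)
  have hroots : Finset.univ.val.map ρ = (P.map (algebraMap F κ)).roots +
      (B.map (algebraMap F κ)).roots := by
    rw [← roots_map_of_map_eq_prod hΦ, hPB, Polynomial.map_mul, roots_mul]
    rwa [← Polynomial.map_mul, ← hPB]
  have hcop := (hP.coprime_iff_not_dvd.2 hB)
  have hmin : ∀ r : κ, minpoly F r = P ↔ aeval r P = 0 := by
    intro r
    constructor
    · rintro rfl
      exact minpoly.aeval _ _
    · intro h
      exact (minpoly.eq_of_irreducible_of_monic hP h hPm).symm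
  have h1 : ((P.map (algebraMap F κ)).roots.filter fun r => minpoly F r = P) =
      (P.map (algebraMap F κ)).roots := by
    refine Multiset.filter_eq_self.2 fun r hr => (hmin r).2 ?_
    rw [aeval_def, ← eval_map]
    exact isRoot_of_mem_roots hr
  have h2 : ((B.map (algebraMap F κ)).roots.filter fun r => minpoly F r = P) = 0 := by
    refine Multiset.filter_eq_nil.2 fun r hr h => ?_
    have hrB : aeval r B = 0 := by
      rw [aeval_def, ← eval_map]
      exact isRoot_of_mem_roots hr
    obtain ⟨u, v, huv⟩ := hcop
    have := congrArg (aeval r) huv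
    rw [map_add, map_mul, map_mul, hrB, (hmin r).1 h] at this
    simp at this
  have h3 := congrArg (fun s => (s.filter fun r => minpoly F r = P).card) hroots
  simp only [Multiset.filter_add, h1, h2, add_zero] at h3
  rw [← hsplit.natDegree_eq_card_roots, natDegree_map, Multiset.filter_map, Multiset.card_map] at h3
  rw [← h3, Set.ncard_eq_toFinset_card']
  rw [← Finset.filter_val]
  congr 2
  ext x
  simp

lemma minpoly_apply_eq (hρ : ∀ x, ρ (σ x) = ρ x ^ Fintype.card F) (x : α) :
    minpoly F (ρ (σ x)) = minpoly F (ρ x) := by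
  rw [hρ, ← congrFun (FiniteField.coe_frobeniusAlgHom F κ) (ρ x)]
  exact minpoly.algHom_eq _ (RingHom.injective _) _

lemma minpoly_eq_of_sameCycle (hρ : ∀ x, ρ (σ x) = ρ x ^ Fintype.card F) {x x' : α}
    (h : σ.SameCycle x x') : minpoly F (ρ x') = minpoly F (ρ x) := by
  obtain ⟨i, rfl⟩ := (sameCycle_iff_exists_iterate σ x x').1 h
  clear h
  induction i with
  | zero => rfl
  | succ i ih => rw [iterate_succ_apply', minpoly_apply_eq hρ, ih]

lemma natDegree_minpoly_dvd (hΦ : Φ.map (algebraMap F κ) = ∏ x, (X - C (ρ x)))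
    (hρ : ∀ x, ρ (σ x) = ρ x ^ Fintype.card F) (x : α) :
    (minpoly F (ρ x)).natDegree ∣ minimalPeriod σ x := by
  have hit : ∀ i, ρ (σ^[i] x) = ρ x ^ Fintype.card F ^ i := by
    intro i
    induction i with
    | zero => simp
    | succ i ih => rw [iterate_succ_apply', hρ, ih, ← pow_mul, pow_succ]
  refine (minpoly.irreducible
    (isIntegral_of_map_eq_prod hΦ x)).natDegree_dvd_of_dvd_X_pow_card_pow_sub_X ?_
  refine minpoly.dvd _ _ ?_
  have := hit (minimalPeriod σ x)
  rw [iterate_minimalPeriod] at this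
  rw [Nat.card_eq_fintype_card, map_sub, map_pow, aeval_X, ← this, sub_self]

lemma exists_minpoly_eq (hΦ : Φ.map (algebraMap F κ) = ∏ x, (X - C (ρ x))) {P : F[X]}
    (hP : Irreducible P) (hPm : P.Monic) (hPΦ : P ∣ Φ) : ∃ x, minpoly F (ρ x) = P := by
  have hΦ0 : Φ.map (algebraMap F κ) ≠ 0 :=
    ((monic_of_map_eq_prod hΦ).map _).ne_zero
  have hsplit : (P.map (algebraMap F κ)).Splits :=
    (splits_of_map_eq_prod hΦ).of_dvd hΦ0 (Polynomial.map_dvd _ hPΦ)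
  obtain ⟨r, hr⟩ := hsplit.exists_eval_eq_zero (by
    rw [degree_map]
    exact hP.degree_pos.ne')
  have hr' : r ∈ (Φ.map (algebraMap F κ)).roots := by
    rw [mem_roots hΦ0]
    exact IsRoot.dvd hr (Polynomial.map_dvd _ hPΦ)
  rw [roots_map_of_map_eq_prod hΦ, Multiset.mem_map] at hr'
  obtain ⟨x, -, rfl⟩ := hr'
  refine ⟨x, (minpoly.eq_of_irreducible_of_monic hP ?_ hPm).symm⟩
  rwa [aeval_def, ← eval_map]

variable {f g : F[X]}

lemma ncard_minpoly_eq_of_mem_simpleFactors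
    (hΦ : Φ.map (algebraMap F κ) = ∏ x, (X - C (ρ x))) (hfg : Φ = f * g)
    {P : F[X]} (hP : P ∈ simpleFactors f g) :
    {x | minpoly F (ρ x) = P}.ncard = P.natDegree := by
  have hf : f ≠ 0 := left_ne_zero_of_mul (hfg ▸ (monic_of_map_eq_prod hΦ).ne_zero)
  obtain ⟨h1, h2, ⟨f', hf'⟩, h4, h5⟩ := (mem_simpleFactors hf).1 hP
  refine ncard_minpoly_eq hΦ (B := f' * g) (by rw [hfg, hf', mul_assoc]) h1 h2 fun h => ?_
  rcases h1.prime.dvd_or_dvd h with h6 | h6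
  · have : P ^ 2 ∣ f := by
      rw [hf', sq]
      exact mul_dvd_mul_left P h6
    rw [pow_dvd_iff_le_count_of_monic h1 h2 hf, h4] at this
    omega
  · exact h5 h6

lemma setOf_sameCycle_eq (hΦ : Φ.map (algebraMap F κ) = ∏ x, (X - C (ρ x)))
    (hρ : ∀ x, ρ (σ x) = ρ x ^ Fintype.card F) (hfg : Φ = f * g) {x : α}
    (hx : minpoly F (ρ x) ∈ simpleFactors f g) :
    {y | σ.SameCycle x y} = {y | minpoly F (ρ y) = minpoly F (ρ x)} := by
  refine Set.eq_of_subset_of_ncard_le (fun y hy => minpoly_eq_of_sameCycle hρ hy) ?_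
    (Set.toFinite _)
  rw [ncard_minpoly_eq_of_mem_simpleFactors hΦ hfg hx, ncard_sameCycle]
  exact Nat.le_of_dvd (minimalPeriod_perm_pos σ x) (natDegree_minpoly_dvd hΦ hρ x)

lemma minimalPeriod_eq_natDegree (hΦ : Φ.map (algebraMap F κ) = ∏ x, (X - C (ρ x)))
    (hρ : ∀ x, ρ (σ x) = ρ x ^ Fintype.card F) (hfg : Φ = f * g) {x : α}
    (hx : minpoly F (ρ x) ∈ simpleFactors f g) :
    minimalPeriod σ x = (minpoly F (ρ x)).natDegree := by
  rw [← ncard_sameCycle, setOf_sameCycle_eq hΦ hρ hfg hx,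
    ncard_minpoly_eq_of_mem_simpleFactors hΦ hfg hx]

lemma ncard_minpoly_mem (hΦ : Φ.map (algebraMap F κ) = ∏ x, (X - C (ρ x))) (hfg : Φ = f * g)
    {T : Finset F[X]} (hT : T ⊆ simpleFactors f g) :
    {x | minpoly F (ρ x) ∈ T}.ncard = ∑ P ∈ T, P.natDegree := by
  rw [Set.ncard_eq_toFinset_card', Finset.card_eq_sum_card_fiberwise (t := T)
    (f := fun x => minpoly F (ρ x)) (fun x hx => by simpa using hx)]
  refine Finset.sum_congr rfl fun P hP => ?_
  rw [← ncard_minpoly_eq_of_mem_simpleFactors hΦ hfg (hT hP), Set.ncard_eq_toFinset_card']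
  congr 1
  ext x
  simp only [Finset.mem_filter, Set.mem_toFinset, Set.mem_ofPred_eq]
  exact ⟨fun h => h.2, fun h => ⟨h ▸ hP, h⟩⟩

lemma ncard_not_mem_simpleFactors_le (hΦ : Φ.map (algebraMap F κ) = ∏ x, (X - C (ρ x)))
    (hfg : Φ = f * g) (hf : f.Monic) :
    {x | minpoly F (ρ x) ∉ simpleFactors f g}.ncard ≤ sqful f + 2 * g.natDegree := by
  have hΦm := monic_of_map_eq_prod hΦ
  have hg : g ≠ 0 := right_ne_zero_of_mul (hfg ▸ hΦm.ne_zero)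
  have h1 := ncard_minpoly_mem hΦ hfg subset_rfl
  have h2 := natDegree_le_sum_simpleFactors hf hg
  have h3 := natDegree_of_map_eq_prod hΦ
  rw [hfg, natDegree_mul hf.ne_zero hg] at h3
  have h4 := Set.ncard_add_ncard_compl {x | minpoly F (ρ x) ∈ simpleFactors f g}
  rw [Nat.card_eq_fintype_card] at h4
  have h5 : {x | minpoly F (ρ x) ∈ simpleFactors f g}ᶜ =
    {x | minpoly F (ρ x) ∉ simpleFactors f g} := rfl
  rw [h5] at h4
  omega

/-- A transitive permutation group containing a permutation whose cycle structure is compatible with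
the factorization of a polynomial with a typical factor of large degree contains the alternating
group. -/
theorem alternatingGroup_le_of_isTypical (G : Subgroup (Perm α)) [MulAction.IsPretransitive G α]
    (hσ : σ ∈ G) (hΦ : Φ.map (algebraMap F κ) = ∏ x, (X - C (ρ x)))
    (hρ : ∀ x, ρ (σ x) = ρ x ^ Fintype.card F) (hfg : Φ = f * g) (hf : f.Monic)
    {K L y N : ℕ} (hg : g.natDegree ≤ L)
    (htyp : IsTypical (Fintype.card α) K (K + 2 * L) y (y ^ 2) N f) (hy : K + 2 * L < y)
    (hN : K + 2 * L < N) (hyN : y * Fintype.card α ≤ N * y ^ 2) :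
    alternatingGroup α ≤ G := by
  have hΦm := monic_of_map_eq_prod hΦ
  have hf0 := hf.ne_zero
  have hg0 : g ≠ 0 := right_ne_zero_of_mul (hfg ▸ hΦm.ne_zero)
  have hsq := htyp.sqful_le
  have hlarge : ∀ P : F[X], Irreducible P → P.Monic → P ∣ f → K + 2 * L < P.natDegree →
      P ∈ simpleFactors f g := fun P h1 h2 h3 h4 =>
    mem_simpleFactors_of_lt hf0 hg0 h1 h2 h3 (by omega) (by omega)
  have hbad : {x | minpoly F (ρ x) ∉ simpleFactors f g}.ncard ≤ K + 2 * L :=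
    (ncard_not_mem_simpleFactors_le hΦ hfg hf).trans (by omega)
  have hexists : ∀ P ∈ simpleFactors f g, ∃ x, minpoly F (ρ x) = P := fun P hP => by
    obtain ⟨h1, h2, h3, -⟩ := (mem_simpleFactors hf0).1 hP
    exact exists_minpoly_eq hΦ h1 h2 (hfg ▸ h3.mul_right g)
  have hlong : ∀ x, K + 2 * L < minimalPeriod σ x → minpoly F (ρ x) ∈ simpleFactors f g := by
    intro x hx
    by_contra hcon
    refine absurd hbad (not_le.2 (hx.trans_le ?_))
    rw [← ncard_sameCycle]
    refine Set.ncard_le_ncard (fun z hz => ?_) (Set.toFinite _)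
    rw [Set.mem_ofPred_eq, minpoly_eq_of_sameCycle hρ hz]
    exact hcon
  obtain ⟨P₀, h1, h2, h3, hprime, hyP, hhalf⟩ := htyp.exists_prime
  have hP₀ := hlarge P₀ h1 h2 h3 (by omega)
  obtain ⟨x₀, rfl⟩ := hexists P₀ hP₀
  obtain ⟨P₁, P₂, hne, ⟨a1, a2, a3⟩, ⟨b1, b2, b3⟩, hN₁, hN₂⟩ := htyp.exists_two
  have hP₁ := hlarge P₁ a1 a2 a3 (by omega)
  have hP₂ := hlarge P₂ b1 b2 b3 (by omega)
  obtain ⟨x₁, rfl⟩ := hexists P₁ hP₁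
  obtain ⟨x₂, rfl⟩ := hexists P₂ hP₂
  have hper := fun {x} hx => minimalPeriod_eq_natDegree (x := x) hΦ hρ hfg hx
  refine alternatingGroup_le_of_cycle_lengths G σ hσ y (y ^ 2) N x₀ x₁ x₂ ?_ ?_ ?_ ?_ ?_ ?_ ?_ ?_ hyN
  · rwa [hper hP₀]
  · rwa [hper hP₀]
  · rwa [hper hP₀]
  · intro x x' m hm hmx hmx'
    have hx := hlong x (lt_of_lt_of_le (by omega)
      (Nat.le_of_dvd (minimalPeriod_perm_pos σ x) hmx))
    have hx' := hlong x' (lt_of_lt_of_le (by omega)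
      (Nat.le_of_dvd (minimalPeriod_perm_pos σ x') hmx'))
    have heq : minpoly F (ρ x') = minpoly F (ρ x) := by
      by_contra hcon
      obtain ⟨c1, c2, c3, -⟩ := (mem_simpleFactors hf0).1 hx
      obtain ⟨d1, d2, d3, -⟩ := (mem_simpleFactors hf0).1 hx'
      rw [hper hx] at hmx
      rw [hper hx'] at hmx'
      exact htyp.not_common ⟨m, _, _, hm, hcon, d1, d2, d3, c1, c2, c3, hmx', hmx⟩
    have : x' ∈ {y | σ.SameCycle x y} := by
      rw [setOf_sameCycle_eq hΦ hρ hfg hx]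
      exact heq
    exact this
  · intro r hr hrR U hU
    have hUc : ∀ x z, σ.SameCycle x z → x ∈ U → z ∈ U := by
      intro x z h hx
      obtain ⟨i, rfl⟩ := (sameCycle_iff_exists_iterate σ x z).1 h
      clear h
      induction i with
      | zero => exact hx
      | succ i ih =>
        rw [iterate_succ_apply']
        exact (hU _).1 ih
    set T := (simpleFactors f g).filter fun P => ∃ x ∈ U, minpoly F (ρ x) = P
    have hT : T ⊆ simpleFactors f g := Finset.filter_subset _ _
    have hTmem : ∀ P ∈ T, Irreducible P ∧ P.Monic ∧ P ∣ f := fun P hP => by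
      obtain ⟨c1, c2, c3, -⟩ := (mem_simpleFactors hf0).1 (hT hP)
      exact ⟨c1, c2, c3⟩
    have hUeq : U = {x | minpoly F (ρ x) ∈ T} ∪
        (U ∩ {x | minpoly F (ρ x) ∉ simpleFactors f g}) := by
      ext x
      constructor
      · intro hx
        by_cases h : minpoly F (ρ x) ∈ simpleFactors f g
        · exact Or.inl (Finset.mem_filter.2 ⟨h, x, hx, rfl⟩)
        · exact Or.inr ⟨hx, h⟩
      · rintro (h | h)
        · obtain ⟨h', z, hz, hzx⟩ := Finset.mem_filter.1 h
          refine hUc z x ?_ hz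
          have : x ∈ {w | σ.SameCycle z w} := by
            rw [setOf_sameCycle_eq hΦ hρ hfg (hzx ▸ h')]
            exact hzx.symm
          exact this
        · exact h.1
    have hcard : U.ncard = (∏ P ∈ T, P).natDegree +
        (U ∩ {x | minpoly F (ρ x) ∉ simpleFactors f g}).ncard := by
      rw [natDegree_prod_of_monic _ _ fun P hP => (hTmem P hP).2.1, ← ncard_minpoly_mem hΦ hfg hT]
      conv_lhs => rw [hUeq]
      refine Set.ncard_union_eq (Set.disjoint_left.2 fun x hx hx' => hx'.2 (hT hx))
        (Set.toFinite _) (Set.toFinite _)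
    rw [hcard]
    refine htyp.natDegree_ne r _ _ hr hrR ?_ ?_ (prod_dvd_of_monic_irreducible hTmem)
    · exact (Set.ncard_le_ncard Set.inter_subset_right (Set.toFinite _)).trans hbad
    · exact monic_prod_of_monic _ _ fun P hP => (hTmem P hP).2.1
  · exact fun h => hne (minpoly_eq_of_sameCycle hρ h).symm
  · rwa [hper hP₁]
  · rwa [hper hP₂]

end FrobeniusCycles

section FrobeniusElement

open Polynomial

lemma exists_frobenius (E : Type) [Field E] [Algebra ℚ E] [FiniteDimensional ℚ E] [IsGalois ℚ E]
    (p : ℕ) [hp : Fact p.Prime] : ∃ (κ : Type) (_ : Field κ) (_ : Algebra (ZMod p) κ)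
      (red : integralClosure ℤ E →+* κ) (σ : E ≃ₐ[ℚ] E), ∀ x, red (σ • x) = red x ^ p := by
  have : CharZero E := algebraRat.charZero E
  let S := integralClosure ℤ E
  have hmax : (Ideal.span {(p : ℤ)}).IsMaximal :=
    PrincipalIdealRing.isMaximal_of_irreducible
      (Nat.prime_iff_prime_int.1 hp.out).irreducible
  obtain ⟨Q, hQ, hQp⟩ := Ideal.exists_ideal_over_maximal_of_isIntegral (S := S)
    (Ideal.span {(p : ℤ)}) (by
      rw [(RingHom.injective_iff_ker_eq_bot _).1 (FaithfulSMul.algebraMap_injective ℤ S)]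
      exact bot_le)
  have hfin : Module.Finite ℤ S := IsIntegralClosure.finite ℤ ℚ E S
  have hfree : Module.Free ℤ S := inferInstance
  have hpQ : (p : S) ∈ Q := by
    have : (p : ℤ) ∈ Q.comap (algebraMap ℤ S) := hQp ▸ Ideal.mem_span_singleton_self _
    simpa using this
  have hfinQ : Finite (S ⧸ Q) := by
    refine Q.finiteQuotientOfFreeOfNeBot fun h => ?_
    rw [h, Ideal.mem_bot, Nat.cast_eq_zero] at hpQ
    exact hp.out.ne_zero hpQ
  have hinv : Algebra.IsInvariant ℤ S (E ≃ₐ[ℚ] E) := by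
    refine ⟨fun b hb => ?_⟩
    have hb' : ∀ g : E ≃ₐ[ℚ] E, g (b : E) = b := fun g => congrArg Subtype.val (hb g)
    obtain ⟨r, hr⟩ := (IsGalois.mem_range_algebraMap_iff_fixed (b : E)).2 hb'
    have hrint : IsIntegral ℤ r := by
      refine (isIntegral_algHom_iff ((Algebra.ofId ℚ E).restrictScalars ℤ)
        (algebraMap ℚ E).injective).1 ?_
      change IsIntegral ℤ (algebraMap ℚ E r)
      rw [hr]
      exact b.2
    obtain ⟨a, ha⟩ := IsIntegrallyClosed.isIntegral_iff.1 hrint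
    refine ⟨a, Subtype.ext ?_⟩
    rw [← hr, ← ha]
    simp
  have hprime : Q.IsPrime := hQ.isPrime
  obtain ⟨σ, hσ⟩ := IsArithFrobAt.exists_of_isInvariant (R := ℤ) (G := E ≃ₐ[ℚ] E) (Q := Q)
  have hcard : Nat.card (ℤ ⧸ Q.under ℤ) = p := by
    change Nat.card (ℤ ⧸ Q.comap (algebraMap ℤ S)) = p
    rw [hQp, Int.card_ideal_quot]
  let : Field (S ⧸ Q) := Ideal.Quotient.field Q
  have : CharP (S ⧸ Q) p := by
    refine (CharP.charP_iff_prime_eq_zero hp.out).2 ?_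
    rw [← map_natCast (Ideal.Quotient.mk Q), Ideal.Quotient.eq_zero_iff_mem]
    exact hpQ
  refine ⟨S ⧸ Q, inferInstance, ZMod.algebra _ p, Ideal.Quotient.mk Q, σ, fun x => ?_⟩
  have := hσ.mk_apply x
  rw [hcard] at this
  exact this

lemma map_eq_prod_rootSet {E : Type} [Field E] [Algebra ℚ E] {ψ : ℚ[X]} (hψ : ψ.Monic)
    (hsplit : (ψ.map (algebraMap ℚ E)).Splits)
    (hcard : Fintype.card (ψ.rootSet E) = ψ.natDegree) :
    ψ.map (algebraMap ℚ E) = ∏ x : ψ.rootSet E, (X - C (x : E)) := by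
  have hroots : (ψ.rootSet E).toFinset = (ψ.aroots E).toFinset := by
    ext x
    simp [rootSet_def]
  have hsep : (ψ.aroots E).Nodup := by
    rw [← Multiset.dedup_card_eq_card_iff_nodup]
    have h1 : (ψ.aroots E).dedup.card = ψ.natDegree := by
      rw [← hcard, ← Set.toFinset_card, hroots]
      rfl
    rw [h1, ← natDegree_map (algebraMap ℚ E), hsplit.natDegree_eq_card_roots]
  rw [hsplit.eq_prod_roots_of_monic (hψ.map _)]
  have h2 : ∏ x : ψ.rootSet E, (X - C (x : E)) =
      ∏ x ∈ (ψ.rootSet E).toFinset, (X - C x : E[X]) := by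
    rw [Finset.prod_subtype (ψ.rootSet E).toFinset (p := fun x => x ∈ ψ.rootSet E)
      (fun x => Set.mem_toFinset)]
  rw [h2, hroots, Finset.prod, Multiset.toFinset_val, hsep.dedup]

lemma exists_frobenius_rootSet_of_isGalois {E : Type} [Field E] [Algebra ℚ E]
    [FiniteDimensional ℚ E] [IsGalois ℚ E] {Φ : ℤ[X]} {ψ : ℚ[X]} (hΦ : Φ.Monic)
    (hψ : ψ = Φ.map (Int.castRingHom ℚ))
    (hprod : ψ.map (algebraMap ℚ E) = ∏ x : ψ.rootSet E, (X - C (x : E)))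
    (p : ℕ) [hp : Fact p.Prime] :
    ∃ (κ : Type) (_ : Field κ) (_ : Algebra (ZMod p) κ) (σ : E ≃ₐ[ℚ] E) (ρ : ψ.rootSet E → κ),
      (Φ.map (Int.castRingHom (ZMod p))).map (algebraMap (ZMod p) κ) = ∏ x, (X - C (ρ x)) ∧
      ∀ x y : ψ.rootSet E, (y : E) = σ x → ρ y = ρ x ^ p := by
  obtain ⟨κ, hκ, hA, red, σ, hσ⟩ := exists_frobenius E p
  have hs_int : ∀ x : ψ.rootSet E, IsIntegral ℤ (x : E) := fun x =>
    ⟨Φ, hΦ, by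
      have h := (mem_rootSet.1 x.2).2
      rw [aeval_def, congrArg (eval₂ (algebraMap ℚ E) (x : E)) hψ, eval₂_map] at h
      rwa [RingHom.ext_int (algebraMap ℤ E) ((algebraMap ℚ E).comp (Int.castRingHom ℚ))]⟩
  let s : ψ.rootSet E → integralClosure ℤ E := fun x => ⟨x, hs_int x⟩
  refine ⟨κ, hκ, hA, σ, fun x => red (s x), ?_, fun x y hxy => ?_⟩
  · have hS : Φ.map (Int.castRingHom (integralClosure ℤ E)) = ∏ x, (X - C (s x)) := by
      apply map_injective (algebraMap (integralClosure ℤ E) E)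
        (FaithfulSMul.algebraMap_injective _ _)
      rw [Polynomial.map_prod, map_map, RingHom.ext_int (RingHom.comp _ _)
        (RingHom.comp (algebraMap ℚ E) (Int.castRingHom ℚ)), ← map_map]
      refine (congrArg (Polynomial.map (algebraMap ℚ E)) hψ.symm).trans (hprod.trans ?_)
      refine Finset.prod_congr rfl fun x _ => ?_
      rw [Polynomial.map_sub, map_X, map_C]
      rfl
    have h := congrArg (Polynomial.map red) hS
    rw [map_map] at h
    rw [map_map, RingHom.ext_int (RingHom.comp _ _) (red.comp (Int.castRingHom _)), h,
      Polynomial.map_prod]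
    refine Finset.prod_congr rfl fun x _ => ?_
    rw [Polynomial.map_sub, map_X, map_C]
  · change red (s y) = red (s x) ^ p
    rw [← hσ]
    congr 1
    exact Subtype.ext hxy

lemma isGalois_splittingField {F : Type*} [Field F] [CharZero F] (p : F[X]) :
    IsGalois F p.SplittingField :=
  { to_isSeparable := inferInstance, to_normal := inferInstance }

/-- Frobenius acts on the complex roots of an integral polynomial compatibly with a reduction of
these roots. -/
theorem exists_frobenius_rootSet {Φ : ℤ[X]} {ψ : ℚ[X]} (hΦ : Φ.Monic)
    (hψ : ψ = Φ.map (Int.castRingHom ℚ))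
    (hcard : Fintype.card (ψ.rootSet ℂ) = Φ.natDegree) (p : ℕ) [hp : Fact p.Prime] :
    ∃ (κ : Type) (_ : Field κ) (_ : Algebra (ZMod p) κ) (σ : ψ.Gal) (ρ : ψ.rootSet ℂ → κ),
      (Φ.map (Int.castRingHom (ZMod p))).map (algebraMap (ZMod p) κ) = ∏ x, (X - C (ρ x)) ∧
      ∀ x, ρ (Polynomial.Gal.galActionHom ψ ℂ σ x) = ρ x ^ p := by
  have hψm : ψ.Monic := by
    rw [hψ]
    exact hΦ.map _
  have hψdeg : ψ.natDegree = Φ.natDegree := by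
    rw [hψ, hΦ.natDegree_map]
  let e := Gal.rootsEquivRoots ψ ℂ
  have hprod := map_eq_prod_rootSet hψm (SplittingField.splits ψ)
    ((Fintype.card_congr e).trans (hcard.trans hψdeg.symm))
  have := isGalois_splittingField ψ
  obtain ⟨κ, hκ, hA, σ, ρ, h1, h2⟩ := exists_frobenius_rootSet_of_isGalois hΦ hψ hprod p
  refine ⟨κ, hκ, hA, σ, fun x => ρ (e.symm x), ?_, fun x => h2 _ _ ?_⟩
  · rw [h1]
    exact (e.symm.prod_comp fun x => X - C (ρ x)).symm
  · change (e.symm (e ((σ : ψ.Gal) • e.symm x))).1 = _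
    rw [e.symm_apply_apply]
    rfl

end FrobeniusElement

section MatrixProb

open Polynomial

lemma not_exists_isTypical_dvd_charpoly {n : ℕ} (M : Matrix (Fin n) (Fin n) ℤ) (p : ℕ)
    [hp : Fact p.Prime] (hcard : Fintype.card ((charQ M).rootSet ℂ) = n)
    (htrans : MulAction.IsPretransitive (charQ M).Gal ((charQ M).rootSet ℂ))
    (halt : ¬ alternatingGroup ((charQ M).rootSet ℂ) ≤
      (Polynomial.Gal.galActionHom (charQ M) ℂ).range)
    {K L y N : ℕ} (hy : K + 2 * L < y) (hN : K + 2 * L < N) (hyN : y * n ≤ N * y ^ 2) :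
    ¬ ∃ f : (ZMod p)[X], f.Monic ∧ f ∣ (M.map (Int.castRingHom (ZMod p))).charpoly ∧
      n ≤ f.natDegree + L ∧ IsTypical n K (K + 2 * L) y (y ^ 2) N f := by
  rintro ⟨f, hf, ⟨g, hfg⟩, hdeg, htyp⟩
  apply halt
  have hM : M.charpoly.natDegree = n := by simp
  obtain ⟨κ, _, _, σ, ρ, hprod, hρ⟩ := exists_frobenius_rootSet (ψ := charQ M)
    M.charpoly_monic rfl (hcard.trans hM.symm) p
  have : MulAction.IsPretransitive (Polynomial.Gal.galActionHom (charQ M) ℂ).range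
      ((charQ M).rootSet ℂ) := by
    refine ⟨fun x y => ?_⟩
    obtain ⟨g, hg⟩ := htrans.exists_smul_eq x y
    exact ⟨⟨_, g, rfl⟩, hg⟩
  have hg : g.natDegree ≤ L := by
    have hmon := (M.map (Int.castRingHom (ZMod p))).charpoly_monic
    rw [hfg] at hmon
    have h := hf.natDegree_mul (hf.of_mul_monic_left hmon)
    rw [← hfg, Matrix.charpoly_natDegree_eq_dim, Fintype.card_fin] at h
    omega
  rw [← Matrix.charpoly_map] at hprod
  have key := alternatingGroup_le_of_isTypical (σ := Polynomial.Gal.galActionHom (charQ M) ℂ σ)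
    (Polynomial.Gal.galActionHom (charQ M) ℂ).range ⟨σ, rfl⟩ hprod
    (fun x => by rw [hρ, ZMod.card]) hfg hf hg (K := K) (y := y) (N := N)
  rw [hcard] at key
  have key2 := key htyp hy hN hyN
  convert key2

variable {μ : ℤ → ℝ} {n : ℕ}

lemma matrixProbZ_eq_sum (hfin : (Function.support μ).Finite)
    (E : Set (Matrix (Fin n) (Fin n) ℤ)) :
    matrixProbZ n μ E =
      ∑ M ∈ Fintype.piFinset fun _ : Fin n => Fintype.piFinset fun _ : Fin n => hfin.toFinset,
        if Matrix.of M ∈ E then ∏ i, ∏ j, μ (M i j) else 0 := by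
  refine (Matrix.of.tsum_eq fun M : Matrix (Fin n) (Fin n) ℤ =>
    if M ∈ E then ∏ i, ∏ j, μ (M i j) else 0).symm.trans (tsum_eq_sum (s := (Fintype.piFinset fun _ : Fin n =>
    Fintype.piFinset fun _ : Fin n => hfin.toFinset)) fun M hM => ?_)
  simp only [Matrix.of_apply]
  obtain ⟨i, j, hij⟩ : ∃ i j, μ (M i j) = 0 := by
    by_contra! h
    exact hM (Fintype.mem_piFinset.2 fun i => Fintype.mem_piFinset.2 fun j =>
      hfin.mem_toFinset.2 (h i j))
  rw [Finset.prod_eq_zero (Finset.mem_univ i) (Finset.prod_eq_zero (Finset.mem_univ j) hij),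
    ite_self]

lemma matrixProbZ_nonneg (hpos : ∀ x, 0 ≤ μ x) (E : Set (Matrix (Fin n) (Fin n) ℤ)) :
    0 ≤ matrixProbZ n μ E := by
  refine tsum_nonneg fun M => ?_
  split_ifs
  · exact Finset.prod_nonneg fun i _ => Finset.prod_nonneg fun j _ => hpos _
  · exact le_rfl

lemma matrixProbZ_mono (hpos : ∀ x, 0 ≤ μ x) (hfin : (Function.support μ).Finite)
    {E E' : Set (Matrix (Fin n) (Fin n) ℤ)} (h : E ⊆ E') :
    matrixProbZ n μ E ≤ matrixProbZ n μ E' := by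
  rw [matrixProbZ_eq_sum hfin, matrixProbZ_eq_sum hfin]
  refine Finset.sum_le_sum fun M _ => ?_
  have h0 : 0 ≤ ∏ i, ∏ j, μ (M i j) :=
    Finset.prod_nonneg fun i _ => Finset.prod_nonneg fun j _ => hpos _
  by_cases hM : Matrix.of M ∈ E
  · rw [if_pos hM, if_pos (h hM)]
  · rw [if_neg hM]
    split_ifs
    exacts [h0, le_rfl]

/-- If the entries are uniform modulo `p`, then the reduction of the matrix modulo `p` is
uniform. -/
lemma matrixProbZ_map_intCast (hfin : (Function.support μ).Finite) (p : ℕ) [Fact p.Prime]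
    (hunif : ∀ a : ZMod p, (∑' x : ℤ, if (x : ZMod p) = a then μ x else 0) = 1 / (p : ℝ))
    (Q : Matrix (Fin n) (Fin n) (ZMod p) → Prop) :
    matrixProbZ n μ {M | Q (M.map (Int.castRingHom (ZMod p)))} =
      (Finset.univ.filter Q).card / (p : ℝ) ^ (n * n) := by
  have hentry (a : ZMod p) : ∑ x ∈ hfin.toFinset with ((x : ℤ) : ZMod p) = a, μ x =
      1 / (p : ℝ) := by
    rw [← hunif a, Finset.sum_filter]
    refine (tsum_eq_sum fun x hx => ?_).symm
    have : μ x = 0 := by simpa using hx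
    rw [this, ite_self]
  have hfiber (A : Matrix (Fin n) (Fin n) (ZMod p)) :
      ∑ M ∈ Fintype.piFinset fun i : Fin n => Fintype.piFinset fun j : Fin n =>
        hfin.toFinset.filter fun x => ((x : ℤ) : ZMod p) = A i j, ∏ i, ∏ j, μ (M i j) =
      1 / (p : ℝ) ^ (n * n) := by
    rw [← Finset.prod_univ_sum _ fun _ (v : Fin n → ℤ) => ∏ j, μ (v j)]
    have (i : Fin n) : ∑ v ∈ Fintype.piFinset fun j : Fin n =>
        hfin.toFinset.filter fun x => ((x : ℤ) : ZMod p) = A i j, ∏ j, μ (v j) =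
        (1 / (p : ℝ)) ^ n := by
      rw [← Finset.prod_univ_sum _ fun _ x => μ x]
      simp [hentry]
    simp only [this, Finset.prod_const, Finset.card_univ, Fintype.card_fin]
    rw [← pow_mul, one_div_pow]
  rw [matrixProbZ_eq_sum hfin, ← Finset.sum_filter, Finset.card_eq_sum_ones, Nat.cast_sum,
    Finset.sum_div]
  simp only [Set.mem_ofPred_eq]
  rw [← Finset.sum_fiberwise_of_maps_to (t := Finset.univ.filter Q)
    (g := fun M : Fin n → Fin n → ℤ => ((Matrix.of M).map (Int.castRingHom (ZMod p))))
    fun M hM => Finset.mem_filter.2 ⟨Finset.mem_univ _, (Finset.mem_filter.1 hM).2⟩]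
  refine Finset.sum_congr rfl fun A hA => ?_
  rw [Nat.cast_one, ← hfiber A]
  refine Finset.sum_congr ?_ fun _ _ => rfl
  ext M
  simp only [Finset.mem_filter, Fintype.mem_piFinset]
  constructor
  · rintro ⟨⟨h1, -⟩, h3⟩ i j
    exact ⟨h1 i j, congrFun (congrFun h3 i) j⟩
  · intro h
    have hMA : (Matrix.of M).map (Int.castRingHom (ZMod p)) = A := by
      ext i j
      exact (h i j).2
    refine ⟨⟨fun i j => (h i j).1, ?_⟩, hMA⟩
    rw [hMA]
    exact (Finset.mem_filter.1 hA).2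

end MatrixProb

theorem stmt5 (μ : ℤ → ℝ) (hpos : ∀ x, 0 ≤ μ x)
    (hfin : (Function.support μ).Finite)
    (hsum : ∑' x : ℤ, μ x = 1)
    (hnt : 1 < (Function.support μ).ncard)
    (p : ℕ) (hp : p.Prime)
    (hunif : ∀ a : ZMod p,
      (∑' x : ℤ, if (x : ZMod p) = a then μ x else 0) = 1 / (p : ℝ)) :
    Filter.Tendsto
      (fun n : ℕ => matrixProbZ n μ
        {M : Matrix (Fin n) (Fin n) ℤ |
          Fintype.card ((charQ M).rootSet ℂ) = n ∧
          MulAction.IsPretransitive (charQ M).Gal ((charQ M).rootSet ℂ) ∧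
          (Polynomial.Gal.galActionHom (charQ M) ℂ).range ≠ ⊤ ∧
          ¬ alternatingGroup ((charQ M).rootSet ℂ) ≤
              (Polynomial.Gal.galActionHom (charQ M) ℂ).range})
      Filter.atTop (nhds 0) := by
  have : Fact p.Prime := ⟨hp⟩
  refine Metric.tendsto_nhds.2 fun ε hε => ?_
  have hp1 : (1 : ℝ) < p := by exact_mod_cast hp.one_lt
  have hp0 : (0 : ℝ) < p := by linarith
  obtain ⟨L, hL⟩ := exists_pow_lt_of_lt_one (show 0 < ε / 4 by positivity)
    (show 1 / (p : ℝ) < 1 from (div_lt_one hp0).2 hp1)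
  obtain ⟨K, hK⟩ := exists_nat_one_div_lt (show 0 < ε / 32 by positivity)
  filter_upwards [eventually_card_not_isTypical_le (ZMod p) L K (K + 2 * L)
    (show 0 < ε / 32 by positivity), Filter.eventually_ne_atTop 0] with n hn hn0
  obtain ⟨y, N, hy, hN, hyN, hcard⟩ := hn
  have hδ : (0 : ℝ) ≤ 4 / (K + 1) + 4 * (ε / 32) := by positivity
  have hmain := card_matrix_charpoly_le hn0 hδ _ hcard
  rw [ZMod.card] at hmain
  rw [Real.dist_eq, sub_zero, abs_of_nonneg (matrixProbZ_nonneg hpos _)]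
  refine (matrixProbZ_mono hpos hfin (fun M hM =>
    not_exists_isTypical_dvd_charpoly M p hM.1 hM.2.1 hM.2.2.2 hy hN hyN)).trans_lt ?_
  refine (matrixProbZ_map_intCast hfin p hunif fun A => ¬ ∃ f : Polynomial (ZMod p),
    f.Monic ∧ f ∣ A.charpoly ∧ n ≤ f.natDegree + L ∧
      IsTypical n K (K + 2 * L) y (y ^ 2) N f).trans_lt ?_
  rw [div_lt_iff₀ (by positivity)]
  refine lt_of_le_of_lt (by convert hmain; rfl) (mul_lt_mul_of_pos_right ?_ (by positivity))
  rw [one_div_pow] at hL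
  have hK' : 4 / ((K : ℝ) + 1) < ε / 8 := by
    rw [show 4 / ((K : ℝ) + 1) = 4 * (1 / (K + 1)) by ring]
    linarith
  linarith
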